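/- Let p ≥ 2, c > 0, and assume A_{i,j} ≥ κ hᵢ for all i, j with κ > 0, and that the partition is σ-shape-regular (max hᵢ ≤ σ min hᵢ). Let u ∈ W̃_β^{2p+1,∞} be an exact solution of −(βu′)′ + γu′ + cu = f on (a,α) ∪ (α,b) with u(a) = u(b) = 0, and let u_T ∈ U_T be an IFVM solution with the same data f. Then there exist h₀ > 0 and C > 0, depending only on p, β⁻, β⁺, γ, c, κ, σ and b−a, such that for h ≤ h₀ the IFVM solution converges with optimal order in L²: (∫_a^b (u(x) − u_T(x))² dx)^{1/2} ≤ C h^{p+1} ‖u‖_{2p+1,∞}. -/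

import Mathlib

open Set

/-- The piecewise-constant diffusion coefficient with interface point `α`. -/
noncomputable def betaPW (βm βp α : ℝ) : ℝ → ℝ := fun t => if t < α then βm else βp

/-- Membership in the immersed trial space `U_T`: continuous on `[a,b]`, zero boundary
values, a polynomial of degree ≤ p on each non-interface element `[x_{i-1}, x_i]` (i ≠ k),
and on the interface element `[x_{k-1}, x_k]` a continuous piecewise polynomial of degree ≤ p
satisfying the derivative jump conditions at the interface `α`. -/
def MemUT (p N k : ℕ) (a b α βm βp : ℝ) (x : ℕ → ℝ) (v : ℝ → ℝ) : Prop :=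
  ContinuousOn v (Set.Icc a b) ∧ v a = 0 ∧ v b = 0 ∧
  (∀ i, 1 ≤ i → i ≤ N → i ≠ k → ∃ q : Polynomial ℝ, q.natDegree ≤ p ∧
    ∀ y ∈ Set.Icc (x (i - 1)) (x i), v y = q.eval y) ∧
  ∃ qm qp : Polynomial ℝ, qm.natDegree ≤ p ∧ qp.natDegree ≤ p ∧
    (∀ y ∈ Set.Icc (x (k - 1)) α, v y = qm.eval y) ∧
    (∀ y ∈ Set.Icc α (x k), v y = qp.eval y) ∧
    ∀ j, 1 ≤ j → j ≤ p →
      βm * ((⇑Polynomial.derivative)^[j] qm).eval α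
        = βp * ((⇑Polynomial.derivative)^[j] qp).eval α

/-- Membership in `W̃_β^{m,∞}`: continuous on `[a,b]`, zero boundary values, `C^m` on each
of `[a,α]` and `[α,b]`, and satisfying the flux jump conditions at `α` for `j = 1,…,m`. -/
def MemW (m : ℕ) (a b α βm βp : ℝ) (u : ℝ → ℝ) : Prop :=
  ContinuousOn u (Set.Icc a b) ∧ u a = 0 ∧ u b = 0 ∧
  ContDiffOn ℝ (m : ℕ∞) u (Set.Icc a α) ∧ ContDiffOn ℝ (m : ℕ∞) u (Set.Icc α b) ∧
  ∀ j, 1 ≤ j → j ≤ m →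
    βm * iteratedDerivWithin j u (Set.Icc a α) α
      = βp * iteratedDerivWithin j u (Set.Icc α b) α

/-- The broken `W^{m,∞}` norm `‖u‖_{m,∞}`: maximum of the piecewise `W^{m,∞}` norms on
`[a,α]` and `[α,b]`. -/
noncomputable def wnorm (m : ℕ) (a b α : ℝ) (u : ℝ → ℝ) : ℝ :=
  max (sSup {y : ℝ | ∃ j ≤ m, ∃ t ∈ Set.Icc a α,
        y = |iteratedDerivWithin j u (Set.Icc a α) t|})
      (sSup {y : ℝ | ∃ j ≤ m, ∃ t ∈ Set.Icc α b,
        y = |iteratedDerivWithin j u (Set.Icc α b) t|})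

/-- A measurable weight with values in `[w₀, w₁]`, `w₀ > 0`, continuous away from `α`. -/
structure IsWeight (w : ℝ → ℝ) (α w₀ w₁ : ℝ) : Prop where
  measurable : Measurable w
  pos : 0 < w₀
  lower : ∀ t, w₀ ≤ w t
  upper : ∀ t, w t ≤ w₁
  continuousAt : ∀ t, t ≠ α → ContinuousAt w t

theorem hasDerivAt_primitive_of_mem_Ioo {F : ℝ → ℝ} {a b t : ℝ}
    (hF : IntervalIntegrable F MeasureTheory.volume a b) (ht : t ∈ Ioo a b)
    (hc : ContinuousAt F t) : HasDerivAt (fun y => ∫ s in a..y, F s) (F t) t := by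
  have hab : a ≤ b := (ht.1.trans ht.2).le
  refine intervalIntegral.integral_hasDerivAt_right (hF.mono_set ?_) ?_ hc
  · rw [uIcc_of_le hab, uIcc_of_le ht.1.le]
    exact Icc_subset_Icc le_rfl ht.2.le
  · refine ⟨Ioo a b, Ioo_mem_nhds ht.1 ht.2, ?_⟩
    have := (intervalIntegrable_iff_integrableOn_Ioc_of_le hab).1 hF
    exact (this.mono_set Ioo_subset_Ioc_self).aestronglyMeasurable

theorem continuousOn_primitive_Icc {F : ℝ → ℝ} {a b : ℝ} (hab : a ≤ b)
    (hF : IntervalIntegrable F MeasureTheory.volume a b) :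
    ContinuousOn (fun y => ∫ s in a..y, F s) (Icc a b) := by
  have h := intervalIntegral.continuousOn_primitive_interval (a := a) (b := b) (f := F)
    (μ := MeasureTheory.volume)
    (by rw [uIcc_of_le hab]; exact (intervalIntegrable_iff_integrableOn_Icc_of_le hab).1 hF)
  rwa [uIcc_of_le hab] at h

theorem ContinuousOn.intervalIntegrable_sub {F : ℝ → ℝ} {a b y z : ℝ}
    (hF : ContinuousOn F (Icc a b)) (hy : y ∈ Icc a b) (hz : z ∈ Icc a b) :
    IntervalIntegrable F MeasureTheory.volume y z :=
  (hF.mono (uIcc_subset_Icc hy hz)).intervalIntegrable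

namespace IsWeight

variable {w : ℝ → ℝ} {α w₀ w₁ : ℝ}

theorem nonneg (hw : IsWeight w α w₀ w₁) (t : ℝ) : 0 ≤ w t := hw.pos.le.trans (hw.lower t)

theorem upper_pos (hw : IsWeight w α w₀ w₁) : 0 < w₁ :=
  hw.pos.trans_le ((hw.lower 0).trans (hw.upper 0))

theorem intervalIntegrable (hw : IsWeight w α w₀ w₁) (y z : ℝ) :
    IntervalIntegrable w MeasureTheory.volume y z := by
  refine (intervalIntegrable_const (c := w₁)).mono_fun hw.measurable.aestronglyMeasurable ?_
  filter_upwards with t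
  rw [Real.norm_of_nonneg (hw.nonneg t), Real.norm_of_nonneg hw.upper_pos.le]
  exact hw.upper t

theorem intervalIntegrable_mul (hw : IsWeight w α w₀ w₁) {F : ℝ → ℝ} {a b y z : ℝ}
    (hF : ContinuousOn F (Icc a b)) (hy : y ∈ Icc a b) (hz : z ∈ Icc a b) :
    IntervalIntegrable (fun t => F t * w t) MeasureTheory.volume y z :=
  (hw.intervalIntegrable y z).continuousOn_mul (hF.mono (uIcc_subset_Icc hy hz))

theorem integral_le (hw : IsWeight w α w₀ w₁) {y z : ℝ} (hyz : y ≤ z) :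
    ∫ t in y..z, w t ≤ w₁ * (z - y) := by
  have := intervalIntegral.integral_mono_on hyz (hw.intervalIntegrable y z)
    (intervalIntegrable_const (c := w₁)) (fun t _ => hw.upper t)
  simpa [mul_comm] using this

theorem le_integral (hw : IsWeight w α w₀ w₁) {y z : ℝ} (hyz : y ≤ z) :
    w₀ * (z - y) ≤ ∫ t in y..z, w t := by
  have := intervalIntegral.integral_mono_on hyz (intervalIntegrable_const (c := w₀))
    (hw.intervalIntegrable y z) (fun t _ => hw.lower t)
  simpa [mul_comm] using this

theorem integral_nonneg (hw : IsWeight w α w₀ w₁) {y z : ℝ} (hyz : y ≤ z) :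
    0 ≤ ∫ t in y..z, w t :=
  intervalIntegral.integral_nonneg hyz fun t _ => hw.nonneg t

/-- Weighted integrals are controlled by the supremum of the integrand. -/
theorem integral_abs_mul_le (hw : IsWeight w α w₀ w₁) {F : ℝ → ℝ} {y z m : ℝ} (hyz : y ≤ z)
    (hF : ContinuousOn F (Icc y z)) (hm : ∀ t ∈ Icc y z, |F t| ≤ m) :
    ∫ t in y..z, |F t| * w t ≤ m * ∫ t in y..z, w t := by
  rw [← intervalIntegral.integral_const_mul]
  refine intervalIntegral.integral_mono_on hyz
    (hw.intervalIntegrable_mul hF.abs (left_mem_Icc.2 hyz) (right_mem_Icc.2 hyz))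
    ((hw.intervalIntegrable y z).const_mul m) fun t ht => ?_
  exact mul_le_mul_of_nonneg_right (hm t ht) (hw.nonneg t)

theorem abs_integral_mul_le_integral (hw : IsWeight w α w₀ w₁) (F : ℝ → ℝ) {y z : ℝ}
    (hyz : y ≤ z) :
    |∫ t in y..z, F t * w t| ≤ ∫ t in y..z, |F t| * w t := by
  refine (intervalIntegral.abs_integral_le_integral_abs hyz).trans (le_of_eq ?_)
  simp only [abs_mul, abs_of_nonneg (hw.nonneg _)]

theorem abs_integral_mul_le (hw : IsWeight w α w₀ w₁) {F : ℝ → ℝ} {y z m : ℝ} (hyz : y ≤ z)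
    (hF : ContinuousOn F (Icc y z)) (hm : ∀ t ∈ Icc y z, |F t| ≤ m) :
    |∫ t in y..z, F t * w t| ≤ m * ∫ t in y..z, w t :=
  (hw.abs_integral_mul_le_integral F hyz).trans (hw.integral_abs_mul_le hyz hF hm)

/-- On a subinterval, a weighted integral is bounded by the full integral of the modulus. -/
theorem abs_integral_mul_le_of_subinterval (hw : IsWeight w α w₀ w₁) {F : ℝ → ℝ} {l r y : ℝ}
    (hF : ContinuousOn F (Icc l r)) (hy : y ∈ Icc l r) :
    |∫ t in l..y, F t * w t| ≤ ∫ t in l..r, |F t| * w t := by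
  refine (hw.abs_integral_mul_le_integral F hy.1).trans ?_
  refine intervalIntegral.integral_mono_interval le_rfl hy.1 hy.2 ?_
    (hw.intervalIntegrable_mul hF.abs (left_mem_Icc.2 (hy.1.trans hy.2))
      (right_mem_Icc.2 (hy.1.trans hy.2)))
  exact Filter.Eventually.of_forall fun t => mul_nonneg (abs_nonneg _) (hw.nonneg t)

end IsWeight

/-- Energy identity estimate: with `z(x) = ∫ y w` vanishing at both ends and
`y = γ (z + π) + c ∫ (z + π) - K'`, the weighted square norm of `y` is controlled by `sup |π|`. -/
theorem energy_estimate {w e z : ℝ → ℝ} {α w₀ w₁ a b γ c K m : ℝ} (hw : IsWeight w α w₀ w₁)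
    (hab : a < b) (hc : 0 < c) (he : ContinuousOn e (Icc a b))
    (hz : ∀ x ∈ Icc a b, z x = ∫ t in a..x, (γ * e t + c * (∫ s in a..t, e s) - K) * w t)
    (hzb : z b = 0) (hπ : ∀ x ∈ Icc a b, |e x - z x| ≤ m) :
    ∫ t in a..b, (γ * e t + c * (∫ s in a..t, e s) - K) ^ 2 * w t
      ≤ 2 * (b - a) * (c + γ ^ 2 * w₁) * m ^ 2 := by
  have ha' : a ∈ Icc a b := left_mem_Icc.2 hab.le
  have hb' : b ∈ Icc a b := right_mem_Icc.2 hab.le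
  have heI := he.intervalIntegrable_sub ha' hb'
  have hE : ContinuousOn (fun x => ∫ s in a..x, e s) (Icc a b) :=
    continuousOn_primitive_Icc hab.le heI
  set E : ℝ → ℝ := fun x => ∫ s in a..x, e s with hEdef
  set y : ℝ → ℝ := fun t => γ * e t + c * E t - K with hydef
  have hy : ContinuousOn y (Icc a b) := by fun_prop
  have hywI := hw.intervalIntegrable_mul hy ha' hb'
  have hzc : ContinuousOn z (Icc a b) := (continuousOn_primitive_Icc hab.le hywI).congr hz
  have hza : z a = 0 := by rw [hz a ha']; simp
  have hzd : ∀ t ∈ Ioo a b \ {α}, HasDerivAt z (y t * w t) t := by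
    rintro t ⟨ht, htα⟩
    have h1 : ContinuousAt (fun t => y t * w t) t :=
      (hy.continuousAt (Icc_mem_nhds ht.1 ht.2)).mul (hw.continuousAt t htα)
    refine (hasDerivAt_primitive_of_mem_Ioo hywI ht h1).congr_of_eventuallyEq ?_
    filter_upwards [Icc_mem_nhds ht.1 ht.2] with x hx using hz x hx
  have hEd : ∀ t ∈ Ioo a b, HasDerivAt E (e t) t := fun t ht =>
    hasDerivAt_primitive_of_mem_Ioo heI ht (he.continuousAt (Icc_mem_nhds ht.1 ht.2))
  have key := MeasureTheory.integral_eq_of_hasDerivAt_off_countable_of_le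
    (fun t => c * (E t * z t) + γ * z t ^ 2 / 2 - K * z t)
    (fun t => c * e t * z t + (y t - γ * (e t - z t)) * y t * w t) hab.le
    (countable_singleton α) (by fun_prop) (fun t ht => by
      have h1 := hzd t ht
      have h2 := hEd t ht.1
      have := (((h2.mul h1).const_mul c).add (((h1.pow 2).const_mul γ).div_const 2)).sub
        (h1.const_mul K)
      refine HasDerivAt.congr_deriv this ?_
      simp only [hydef]; norm_num; ring)
    ((ContinuousOn.intervalIntegrable_sub (by fun_prop) ha' hb').add
      (hw.intervalIntegrable_mul (by fun_prop) ha' hb'))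
  have hzero : ∫ t in a..b, (c * e t * z t + (y t - γ * (e t - z t)) * y t * w t) = 0 := by
    rw [key]; simp [hza, hzb]
  have hmono := intervalIntegral.integral_mono_on hab.le
    (f := fun t => y t ^ 2 * w t * (1 / 2) - (c + γ ^ 2 * w₁) * m ^ 2)
    (((hw.intervalIntegrable_mul (by fun_prop) ha' hb').mul_const _).sub intervalIntegrable_const)
    ((ContinuousOn.intervalIntegrable_sub (by fun_prop) ha' hb').add
      (hw.intervalIntegrable_mul (by fun_prop) ha' hb'))
    (g := fun t => c * e t * z t + (y t - γ * (e t - z t)) * y t * w t) (fun t ht => by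
      have h1 := hπ t ht
      have h2 : (e t - z t) ^ 2 ≤ m ^ 2 := sq_le_sq' (by linarith [abs_le.1 h1]) (abs_le.1 h1).2
      have h3 : -(c * m ^ 2) ≤ c * e t * z t := by
        nlinarith [mul_nonneg hc.le (sq_nonneg (2 * z t + (e t - z t))),
          mul_le_mul_of_nonneg_left h2 hc.le, mul_nonneg hc.le (sq_nonneg m)]
      have h4 : y t ^ 2 / 2 - γ ^ 2 * m ^ 2 ≤ (y t - γ * (e t - z t)) * y t := by
        nlinarith [sq_nonneg (y t - γ * (e t - z t)), sq_nonneg γ,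
          mul_le_mul_of_nonneg_left h2 (sq_nonneg γ), mul_nonneg (sq_nonneg γ) (sq_nonneg m)]
      have h5 := mul_le_mul_of_nonneg_right h4 (hw.nonneg t)
      have h6 := mul_le_mul_of_nonneg_left (hw.upper t)
        (mul_nonneg (sq_nonneg γ) (sq_nonneg m))
      linarith)
  rw [hzero, intervalIntegral.integral_sub
    ((hw.intervalIntegrable_mul (by fun_prop) ha' hb').mul_const _) intervalIntegrable_const,
    intervalIntegral.integral_mul_const, intervalIntegral.integral_const] at hmono
  simp only [smul_eq_mul] at hmono
  linarith

/-- Stability of the integrated two-point boundary value problem in the maximum norm. -/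
theorem exists_stability_const (w₀ w₁ γ c d : ℝ) (hw₀ : 0 < w₀) (hw₁ : 0 < w₁) (hc : 0 < c)
    (hd : 0 < d) :
    ∃ C : ℝ, 0 < C ∧ ∀ (w e : ℝ → ℝ) (α a b K m : ℝ), IsWeight w α w₀ w₁ → b - a = d →
      0 < m → ContinuousOn e (Icc a b) → e b = 0 →
      (∀ x ∈ Icc a b,
        |e x - ∫ t in a..x, (γ * e t + c * (∫ s in a..t, e s) - K) * w t| ≤ m) →
      (∀ x ∈ Icc a b, |e x| ≤ C * m) ∧ |K| ≤ C * m := by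
  set S : ℝ := 2 * d * (c + γ ^ 2 * w₁) with hS
  have hS0 : 0 < S := by positivity
  set C₁ : ℝ := 2 * S + d * w₁ / 2 + 2 with hC₁
  have hC₁0 : 0 < C₁ := by positivity
  refine ⟨C₁ + (|γ| + c * d) * C₁ + 1 / (w₀ * d), by positivity, ?_⟩
  intro w e α a b K m hw hab' hm he heb hP
  have hab : a < b := by linarith
  have ha' : a ∈ Icc a b := left_mem_Icc.2 hab.le
  have hb' : b ∈ Icc a b := right_mem_Icc.2 hab.le
  have heI := he.intervalIntegrable_sub ha' hb'
  have hE : ContinuousOn (fun x => ∫ s in a..x, e s) (Icc a b) :=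
    continuousOn_primitive_Icc hab.le heI
  set E : ℝ → ℝ := fun x => ∫ s in a..x, e s with hEdef
  set G : ℝ → ℝ := fun t => γ * e t + c * E t - K with hG
  have hGc : ContinuousOn G (Icc a b) := by fun_prop
  set L : ℝ := ∫ t in a..b, w t with hL
  have hLlow : w₀ * d ≤ L := hab' ▸ hw.le_integral hab.le
  have hLup : L ≤ w₁ * d := hab' ▸ hw.integral_le hab.le
  have hL0 : 0 < L := lt_of_lt_of_le (by positivity) hLlow
  set Pb : ℝ := e b - ∫ t in a..b, G t * w t with hPb
  have hPbm : |Pb| ≤ m := hP b hb'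
  set K' : ℝ := K - Pb / L with hK'
  set z : ℝ → ℝ := fun x => ∫ t in a..x, (γ * e t + c * E t - K') * w t with hz
  have hzx : ∀ x ∈ Icc a b, z x = (∫ t in a..x, G t * w t) + Pb / L * ∫ t in a..x, w t := by
    intro x hx
    rw [← intervalIntegral.integral_const_mul, ← intervalIntegral.integral_add
      (hw.intervalIntegrable_mul hGc ha' hx) ((hw.intervalIntegrable a x).const_mul _)]
    refine intervalIntegral.integral_congr fun t _ => ?_
    simp only [hG, hK']; ring
  have hzb : z b = 0 := by
    rw [hzx b hb', ← hL, div_mul_cancel₀ _ hL0.ne', hPb, heb]; ring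
  have hπ : ∀ x ∈ Icc a b, |e x - z x| ≤ 2 * m := by
    intro x hx
    have h1 : 0 ≤ ∫ t in a..x, w t := hw.integral_nonneg hx.1
    have h2 : ∫ t in a..x, w t ≤ L := by
      have := intervalIntegral.integral_add_adjacent_intervals (hw.intervalIntegrable a x)
        (hw.intervalIntegrable x b)
      have h3 := hw.integral_nonneg hx.2
      rw [hL]; linarith
    have h3 : |Pb / L * ∫ t in a..x, w t| ≤ m := by
      rw [abs_mul, abs_div, abs_of_pos hL0, abs_of_nonneg h1, div_mul_eq_mul_div, div_le_iff₀ hL0]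
      exact mul_le_mul hPbm h2 h1 hm.le
    have h4 := hP x hx
    have h5 : e x - z x = (e x - ∫ t in a..x, G t * w t) - Pb / L * ∫ t in a..x, w t := by
      rw [hzx x hx]; ring
    rw [h5]
    exact (abs_sub _ _).trans (by linarith)
  have hen := energy_estimate hw hab hc he (fun x _ => rfl) hzb hπ
  rw [hab'] at hen
  have hyc : ContinuousOn (fun t => γ * e t + c * E t - K') (Icc a b) := by fun_prop
  have hyc2 : ContinuousOn (fun t => (γ * e t + c * E t - K') ^ 2) (Icc a b) := hyc.pow 2
  have hzm : ∀ x ∈ Icc a b, |z x| ≤ 2 * S * m + m * d * w₁ / 2 := by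
    intro x hx
    refine (hw.abs_integral_mul_le_of_subinterval hyc hx).trans ?_
    have hmono := intervalIntegral.integral_mono_on hab.le
      (f := fun t => |γ * e t + c * E t - K'| * w t)
      (g := fun t => (γ * e t + c * E t - K') ^ 2 * w t * (1 / (2 * m)) + w t * (m / 2))
      (hw.intervalIntegrable_mul hyc.abs ha' hb')
      (((hw.intervalIntegrable_mul hyc2 ha' hb').mul_const _).add
        ((hw.intervalIntegrable a b).mul_const _)) (fun t _ => by
        have h : |γ * e t + c * E t - K'| ≤
            (γ * e t + c * E t - K') ^ 2 * (1 / (2 * m)) + m / 2 := by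
          rw [← sq_abs]
          set v := |γ * e t + c * E t - K'|
          have : v ^ 2 * (1 / (2 * m)) + m / 2 - v = (v - m) ^ 2 / (2 * m) := by
            field_simp; ring
          have h0 : 0 ≤ (v - m) ^ 2 / (2 * m) := by positivity
          linarith
        have := mul_le_mul_of_nonneg_right h (hw.nonneg t)
        linarith)
    rw [intervalIntegral.integral_add
      ((hw.intervalIntegrable_mul hyc2 ha' hb').mul_const _)
        ((hw.intervalIntegrable a b).mul_const _), intervalIntegral.integral_mul_const,
      intervalIntegral.integral_mul_const, ← hL] at hmono
    refine hmono.trans ?_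
    have h1 := mul_le_mul_of_nonneg_right hen (by positivity : 0 ≤ 1 / (2 * m))
    have h2 : S * (2 * m) ^ 2 * (1 / (2 * m)) = 2 * S * m := by field_simp
    have h3 := mul_le_mul_of_nonneg_right hLup (by positivity : 0 ≤ m / 2)
    rw [← hS, h2] at h1
    exact (add_le_add h1 h3).trans (le_of_eq (by ring))
  have hem : ∀ x ∈ Icc a b, |e x| ≤ C₁ * m := by
    intro x hx
    have h1 := hzm x hx
    have h2 := hπ x hx
    have h3 : |e x| ≤ |z x| + |e x - z x| := by
      simpa using abs_add_le (z x) (e x - z x)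
    rw [hC₁]; linarith
  have hEm : ∀ x ∈ Icc a b, |E x| ≤ C₁ * m * d := by
    intro x hx
    have h1 := intervalIntegral.norm_integral_le_of_norm_le_const (a := a) (b := x) (f := e)
      (C := C₁ * m) (fun t ht => by
        rw [uIoc_of_le hx.1] at ht
        exact hem t ⟨ht.1.le, ht.2.trans hx.2⟩)
    refine h1.trans (mul_le_mul_of_nonneg_left ?_ (by positivity))
    rw [abs_of_nonneg (by linarith [hx.1])]; linarith [hx.2]
  have hK'b : |K'| ≤ (|γ| + c * d) * C₁ * m := by
    have h1 : ∫ t in a..b, (γ * e t + c * E t) * w t = K' * L := by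
      have h2 : ∫ t in a..b, (γ * e t + c * E t - K') * w t = 0 := hzb
      have h3 : ∀ t, (γ * e t + c * E t - K') * w t = (γ * e t + c * E t) * w t - K' * w t :=
        fun t => by ring
      simp only [h3] at h2
      rw [intervalIntegral.integral_sub (hw.intervalIntegrable_mul (by fun_prop) ha' hb')
        ((hw.intervalIntegrable a b).const_mul _), intervalIntegral.integral_const_mul] at h2
      linarith
    have h2 := hw.abs_integral_mul_le (F := fun t => γ * e t + c * E t)
      (m := (|γ| + c * d) * C₁ * m) hab.le (by fun_prop) (fun t ht => by
        refine (abs_add_le _ _).trans ?_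
        rw [abs_mul, abs_mul, abs_of_pos hc]
        have h3 := mul_le_mul_of_nonneg_left (hem t ht) (abs_nonneg γ)
        have h4 := mul_le_mul_of_nonneg_left (hEm t ht) hc.le
        linarith)
    rw [h1, abs_mul, abs_of_pos hL0] at h2
    exact le_of_mul_le_mul_right h2 hL0
  have hPL : |Pb / L| ≤ 1 / (w₀ * d) * m := by
    rw [abs_div, abs_of_pos hL0, div_mul_eq_mul_div, one_mul]
    exact div_le_div₀ hm.le hPbm (by positivity) hLlow
  have h1 : 0 ≤ (|γ| + c * d) * C₁ * m := by positivity
  have h2 : 0 ≤ 1 / (w₀ * d) * m := by positivity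
  have h3 : 0 ≤ C₁ * m := by positivity
  refine ⟨fun x hx => (hem x hx).trans (by linarith), ?_⟩
  have h4 : |K| ≤ |K'| + |Pb / L| := by simpa [hK'] using abs_add_le K' (Pb / L)
  linarith

section Quadrature

variable {w : ℝ → ℝ} {α w₀ w₁ : ℝ} {p : ℕ} {l r : ℝ} {g A : ℕ → ℝ}

theorem sum_weights_eq_integral
    (hq : ∀ F : Polynomial ℝ, F.natDegree ≤ 2 * p - 1 →
      ∑ j ∈ Finset.Icc 1 p, A j * F.eval (g j) = ∫ t in l..r, F.eval t * w t) :
    ∑ j ∈ Finset.Icc 1 p, A j = ∫ t in l..r, w t := by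
  simpa using hq 1 (by simp)

/-- A quadrature rule with positive weights bounds the integral of a polynomial by its
values at the nodes. -/
theorem abs_integral_le_of_nodes (hA : ∀ j ∈ Finset.Icc 1 p, 0 < A j)
    (hq : ∀ F : Polynomial ℝ, F.natDegree ≤ 2 * p - 1 →
      ∑ j ∈ Finset.Icc 1 p, A j * F.eval (g j) = ∫ t in l..r, F.eval t * w t)
    {s : Polynomial ℝ} (hs : s.natDegree ≤ 2 * p - 1) {m : ℝ}
    (hm : ∀ j ∈ Finset.Icc 1 p, |s.eval (g j)| ≤ m) :
    |∫ t in l..r, s.eval t * w t| ≤ m * ∫ t in l..r, w t := by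
  rw [← hq s hs, ← sum_weights_eq_integral hq, Finset.mul_sum]
  refine (Finset.abs_sum_le_sum_abs _ _).trans (Finset.sum_le_sum fun j hj => ?_)
  rw [abs_mul, abs_of_pos (hA j hj), mul_comm]
  exact mul_le_mul_of_nonneg_right (hm j hj) (hA j hj).le

/-- A quadrature rule with positive weights that integrates squares exactly bounds the
weighted `L¹` norm of a polynomial by its values at the nodes. -/
theorem integral_abs_le_of_nodes (hw : IsWeight w α w₀ w₁) (hlr : l ≤ r)
    (hA : ∀ j ∈ Finset.Icc 1 p, 0 < A j)
    (hq : ∀ F : Polynomial ℝ, F.natDegree ≤ 2 * p - 1 →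
      ∑ j ∈ Finset.Icc 1 p, A j * F.eval (g j) = ∫ t in l..r, F.eval t * w t)
    {s : Polynomial ℝ} (hs : s.natDegree ≤ p - 1) {m : ℝ} (hm0 : 0 < m)
    (hm : ∀ j ∈ Finset.Icc 1 p, |s.eval (g j)| ≤ m) :
    ∫ t in l..r, |s.eval t| * w t ≤ m * ∫ t in l..r, w t := by
  have hl := left_mem_Icc.2 hlr
  have hr := right_mem_Icc.2 hlr
  have h2 := abs_integral_le_of_nodes hA hq (s := s ^ 2) (m := m ^ 2)
    ((Polynomial.natDegree_pow_le).trans (by omega)) (fun j hj => by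
      rw [Polynomial.eval_pow, abs_pow]
      exact pow_le_pow_left₀ (abs_nonneg _) (hm j hj) 2)
  have h3 := (le_abs_self _).trans h2
  have hsc : ContinuousOn (fun t => |s.eval t|) (Icc l r) := s.continuous.abs.continuousOn
  have hsc2 : ContinuousOn (fun t => (s ^ 2).eval t) (Icc l r) := (s ^ 2).continuous.continuousOn
  have hmono := intervalIntegral.integral_mono_on hlr
    (f := fun t => |s.eval t| * w t)
    (g := fun t => (s ^ 2).eval t * w t * (1 / (2 * m)) + w t * (m / 2))
    (hw.intervalIntegrable_mul hsc hl hr)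
    (((hw.intervalIntegrable_mul hsc2 hl hr).mul_const _).add
      ((hw.intervalIntegrable l r).mul_const _)) (fun t _ => by
      have h : |s.eval t| ≤ (s ^ 2).eval t * (1 / (2 * m)) + m / 2 := by
        rw [Polynomial.eval_pow, ← sq_abs]
        set v := |s.eval t|
        have : v ^ 2 * (1 / (2 * m)) + m / 2 - v = (v - m) ^ 2 / (2 * m) := by
          field_simp; ring
        have h0 : 0 ≤ (v - m) ^ 2 / (2 * m) := by positivity
        linarith
      have := mul_le_mul_of_nonneg_right h (hw.nonneg t)
      linarith)
  rw [intervalIntegral.integral_add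
    ((hw.intervalIntegrable_mul hsc2 hl hr).mul_const _)
      ((hw.intervalIntegrable l r).mul_const _), intervalIntegral.integral_mul_const,
    intervalIntegral.integral_mul_const] at hmono
  refine hmono.trans ?_
  have h4 := mul_le_mul_of_nonneg_right h3 (by positivity : 0 ≤ 1 / (2 * m))
  have h5 : (m ^ 2 * ∫ t in l..r, w t) * (1 / (2 * m)) = (∫ t in l..r, w t) * (m / 2) := by
    field_simp
  rw [h5] at h4
  linarith

end Quadrature

theorem Polynomial.exists_derivative_eq (T : Polynomial ℝ) (l v : ℝ) :
    ∃ S : Polynomial ℝ, S.natDegree ≤ T.natDegree + 1 ∧ Polynomial.derivative S = T ∧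
      S.eval l = v := by
  set S₀ : Polynomial ℝ := ∑ i ∈ Finset.range (T.natDegree + 1),
    Polynomial.monomial (i + 1) (T.coeff i / (i + 1)) with hS₀
  have hd : S₀.natDegree ≤ T.natDegree + 1 := by
    refine Polynomial.natDegree_sum_le_of_forall_le _ _ fun i hi => ?_
    have := Finset.mem_range.1 hi
    exact (Polynomial.natDegree_monomial_le _).trans (by omega)
  have hder : Polynomial.derivative S₀ = T := by
    rw [hS₀, Polynomial.derivative_sum]
    conv_rhs => rw [T.as_sum_range]
    refine Finset.sum_congr rfl fun i _ => ?_
    rw [Polynomial.derivative_monomial, Nat.add_sub_cancel]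
    congr 1
    push_cast
    field_simp
  refine ⟨S₀ + Polynomial.C (v - S₀.eval l), ?_, by simp [hder], by simp⟩
  exact Polynomial.natDegree_add_le_of_degree_le hd (by simp)

/-- Taylor approximation for a chain of functions `Q j` with `Q j' = Q (j + 1)`. -/
theorem exists_taylor_polynomial {l r M : ℝ} (hlr : l ≤ r) (n : ℕ) (Q : ℕ → ℝ → ℝ)
    (hQ : ∀ j ≤ n, ∀ t ∈ Icc l r, HasDerivWithinAt (Q j) (Q (j + 1) t) (Icc l r) t)
    (hM : ∀ t ∈ Icc l r, |Q (n + 1) t| ≤ M) :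
    ∃ T : Polynomial ℝ, T.natDegree ≤ n ∧
      ∀ t ∈ Icc l r, |Q 0 t - T.eval t| ≤ M * (t - l) ^ (n + 1) := by
  have hl := left_mem_Icc.2 hlr
  have hM0 : 0 ≤ M := (abs_nonneg _).trans (hM l hl)
  induction n generalizing Q with
  | zero =>
    refine ⟨Polynomial.C (Q 0 l), by simp, fun t ht => ?_⟩
    have := Convex.norm_image_sub_le_of_norm_hasDerivWithin_le (hQ 0 le_rfl) hM
      (convex_Icc l r) hl ht
    simpa [Real.norm_eq_abs, abs_of_nonneg (sub_nonneg.2 ht.1)] using this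
  | succ n ih =>
    obtain ⟨T₁, hT₁, hb⟩ := ih (fun j => Q (j + 1)) (fun j hj => hQ (j + 1) (by omega)) hM
    obtain ⟨T, hTd, hT, hTl⟩ := T₁.exists_derivative_eq l (Q 0 l)
    refine ⟨T, hTd.trans (by omega), fun t ht => ?_⟩
    have hsub : Icc l t ⊆ Icc l r := Icc_subset_Icc le_rfl ht.2
    have := Convex.norm_image_sub_le_of_norm_hasDerivWithin_le (s := Icc l t)
      (f := fun s => Q 0 s - T.eval s) (f' := fun s => Q 1 s - T₁.eval s)
      (C := M * (t - l) ^ (n + 1))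
      (fun s hs => ((hQ 0 (by omega) s (hsub hs)).mono hsub).sub
        (hT ▸ (T.hasDerivAt s).hasDerivWithinAt))
      (fun s hs => (hb s (hsub hs)).trans (mul_le_mul_of_nonneg_left
        (pow_le_pow_left₀ (sub_nonneg.2 hs.1) (by linarith [hs.2]) _) hM0))
      (convex_Icc l t) (left_mem_Icc.2 ht.1) (right_mem_Icc.2 ht.1)
    rw [Real.norm_eq_abs, Real.norm_eq_abs, abs_of_nonneg (sub_nonneg.2 ht.1), hTl, sub_self,
      sub_zero] at this
    exact this.trans (le_of_eq (by ring))

/-- Elementwise consistency of the collocation relations. -/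
theorem element_estimate {w : ℝ → ℝ} {α w₀ w₁ : ℝ} {p : ℕ} (hp : 2 ≤ p) {l r M ω : ℝ}
    {g A : ℕ → ℝ} (hw : IsWeight w α w₀ w₁) (hlr : l ≤ r) (hM0 : 0 < M)
    (hA : ∀ j ∈ Finset.Icc 1 p, 0 < A j) (hg : ∀ j ∈ Finset.Icc 1 p, g j ∈ Icc l r)
    (hq : ∀ F : Polynomial ℝ, F.natDegree ≤ 2 * p - 1 →
      ∑ j ∈ Finset.Icc 1 p, A j * F.eval (g j) = ∫ t in l..r, F.eval t * w t)
    {T q : Polynomial ℝ} {n : ℕ} {Q G : ℝ → ℝ} (hT : T.natDegree ≤ n)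
    (hqd : q.natDegree ≤ p - 1)
    (hQ : ContinuousOn Q (Icc l r)) (hTm : ∀ t ∈ Icc l r, |Q t - T.eval t| ≤ M)
    (hG : ContinuousOn G (Icc l r)) (hω : ∀ t ∈ Icc l r, |G t - G l| ≤ ω)
    (hcol : ∀ j ∈ Finset.Icc 1 p, Q (g j) - q.eval (g j) = G (g j)) :
    (n ≤ p - 1 → ∫ t in l..r, |Q t - q.eval t - G t| * w t
      ≤ 2 * (M + ω) * ∫ t in l..r, w t) ∧
    (n ≤ p → |∫ t in l..r, (Q t - q.eval t - G t) * w t|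
      ≤ 2 * (M + ω) * ∫ t in l..r, w t) := by
  have hl := left_mem_Icc.2 hlr
  have hr := right_mem_Icc.2 hlr
  have hω0 : 0 ≤ ω := (abs_nonneg _).trans (hω l hl)
  set s : Polynomial ℝ := T - q - Polynomial.C (G l) with hs
  have hse : ∀ t, s.eval t = T.eval t - q.eval t - G l := fun t => by simp [hs]
  have hsd : s.natDegree ≤ max n (p - 1) := by
    refine (Polynomial.natDegree_sub_le_of_le (n := 0)
      (Polynomial.natDegree_sub_le_of_le hT hqd) (by simp)).trans (by simp)
  have hsm : ∀ j ∈ Finset.Icc 1 p, |s.eval (g j)| ≤ M + ω := by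
    intro j hj
    have h1 := hTm _ (hg j hj)
    have h2 := hω _ (hg j hj)
    have h3 : s.eval (g j) = (G (g j) - G l) - (Q (g j) - T.eval (g j)) := by
      rw [hse, ← hcol j hj]; ring
    rw [h3]
    exact (abs_sub _ _).trans (by linarith)
  set R : ℝ → ℝ := fun t => (Q t - T.eval t) - (G t - G l) with hR
  have hTc : ContinuousOn (fun t => T.eval t) (Icc l r) := T.continuous.continuousOn
  have hqc : ContinuousOn (fun t => q.eval t) (Icc l r) := q.continuous.continuousOn
  have hsc : ContinuousOn (fun t => s.eval t) (Icc l r) := s.continuous.continuousOn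
  have hRc : ContinuousOn R (Icc l r) := by fun_prop
  have hRm : ∀ t ∈ Icc l r, |R t| ≤ M + ω := fun t ht =>
    (abs_sub _ _).trans (by linarith [hTm t ht, hω t ht])
  have hsplit : ∀ t, Q t - q.eval t - G t = R t + s.eval t := fun t => by
    rw [hse]; simp only [hR]; ring
  constructor
  · intro hn
    have h1 := hw.integral_abs_mul_le hlr hRc hRm
    have h2 := integral_abs_le_of_nodes hw hlr hA hq (s := s) (hsd.trans (by omega))
      (by positivity) hsm
    have h3 := intervalIntegral.integral_mono_on hlr
      (f := fun t => |Q t - q.eval t - G t| * w t)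
      (g := fun t => |R t| * w t + |s.eval t| * w t)
      (hw.intervalIntegrable_mul (by fun_prop) hl hr)
      ((hw.intervalIntegrable_mul hRc.abs hl hr).add
        (hw.intervalIntegrable_mul hsc.abs hl hr)) (fun t _ => by
        rw [hsplit, ← add_mul]
        exact mul_le_mul_of_nonneg_right (abs_add_le _ _) (hw.nonneg t))
    rw [intervalIntegral.integral_add (hw.intervalIntegrable_mul hRc.abs hl hr)
      (hw.intervalIntegrable_mul hsc.abs hl hr)] at h3
    linarith
  · intro hn
    have h1 := hw.abs_integral_mul_le hlr hRc hRm
    have h2 := abs_integral_le_of_nodes hA hq (s := s) (hsd.trans (by omega)) hsm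
    simp only [hsplit, add_mul]
    rw [intervalIntegral.integral_add (hw.intervalIntegrable_mul hRc hl hr)
      (hw.intervalIntegrable_mul hsc hl hr)]
    exact (abs_add_le _ _).trans (by linarith)

/-- Fundamental theorem of calculus for a function whose derivative is `F * w` away from `α`. -/
theorem IsWeight.sub_eq_integral {w : ℝ → ℝ} {α w₀ w₁ l r y : ℝ} {e F : ℝ → ℝ}
    (hw : IsWeight w α w₀ w₁) (he : ContinuousOn e (Icc l r)) (hF : ContinuousOn F (Icc l r))
    (hder : ∀ t ∈ Ioo l r, t ≠ α → HasDerivAt e (F t * w t) t) (hy : y ∈ Icc l r) :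
    e y - e l = ∫ t in l..y, F t * w t := by
  have hsub : Icc l y ⊆ Icc l r := Icc_subset_Icc le_rfl hy.2
  refine (MeasureTheory.integral_eq_of_hasDerivAt_off_countable_of_le e _ hy.1
    (countable_singleton α) (he.mono hsub) (fun t ht => ?_)
    (hw.intervalIntegrable_mul hF (left_mem_Icc.2 (hy.1.trans hy.2)) hy)).symm
  exact hder t ⟨ht.1.1, ht.1.2.trans_le hy.2⟩ ht.2

/-- Element bounds for the defect `Q - q - G` of the collocation relations, where
`G = γ e + c ∫ e - K` is controlled by `Γ` and `e` by `ε`. -/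
theorem element_defect_bounds {w : ℝ → ℝ} {α w₀ w₁ γ c K : ℝ} {p : ℕ} (hp : 2 ≤ p)
    {a b l r h M Γ ε : ℝ} {g A : ℕ → ℝ} (hw : IsWeight w α w₀ w₁) (hc : 0 < c)
    (hlr : l < r) (hal : a ≤ l) (hrb : r ≤ b) (hh : r - l ≤ h) (hsmall : 4 * |γ| * w₁ * h ≤ 1)
    (hM0 : 0 < M)
    (hA : ∀ j ∈ Finset.Icc 1 p, 0 < A j) (hg : ∀ j ∈ Finset.Icc 1 p, g j ∈ Icc l r)
    (hq : ∀ F : Polynomial ℝ, F.natDegree ≤ 2 * p - 1 →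
      ∑ j ∈ Finset.Icc 1 p, A j * F.eval (g j) = ∫ t in l..r, F.eval t * w t)
    {q : Polynomial ℝ} {Q : ℕ → ℝ → ℝ} {e : ℝ → ℝ} (hqd : q.natDegree ≤ p - 1)
    (hQ : ∀ j ≤ p, ∀ t ∈ Icc l r, HasDerivWithinAt (Q j) (Q (j + 1) t) (Icc l r) t)
    (hQM : ∀ j ≤ p + 1, ∀ t ∈ Icc l r, |Q j t| ≤ M)
    (he : ContinuousOn e (Icc a b))
    (hder : ∀ t ∈ Ioo l r, t ≠ α → HasDerivAt e ((Q 0 t - q.eval t) * w t) t)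
    (hΓ : ∀ t ∈ Icc a b, |γ * e t + c * (∫ s in a..t, e s) - K| ≤ Γ)
    (hε : ∀ t ∈ Icc a b, |e t| ≤ ε)
    (hcol : ∀ j ∈ Finset.Icc 1 p,
      Q 0 (g j) - q.eval (g j) = γ * e (g j) + c * (∫ s in a..(g j), e s) - K)
    {ω : ℝ} (hωdef : ω = 2 * h * (|γ| * w₁ * (2 * (M * h ^ p) + Γ) + c * ε)) :
    (∫ t in l..r, |Q 0 t - q.eval t - (γ * e t + c * (∫ s in a..t, e s) - K)| * w t
      ≤ 2 * (M * h ^ p + ω) * ∫ t in l..r, w t) ∧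
    |∫ t in l..r, (Q 0 t - q.eval t - (γ * e t + c * (∫ s in a..t, e s) - K)) * w t|
      ≤ 2 * (M * h ^ (p + 1) + ω) * ∫ t in l..r, w t := by
  have hl := left_mem_Icc.2 hlr.le
  have hr := right_mem_Icc.2 hlr.le
  have hab : a ≤ b := by linarith
  have ha' := left_mem_Icc.2 hab
  have hb' := right_mem_Icc.2 hab
  have hsub : Icc l r ⊆ Icc a b := Icc_subset_Icc hal hrb
  have h0 : 0 < h := by linarith
  have heI := he.intervalIntegrable_sub ha' hb'
  have hE : ContinuousOn (fun x => ∫ s in a..x, e s) (Icc a b) :=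
    continuousOn_primitive_Icc hab heI
  set E : ℝ → ℝ := fun x => ∫ s in a..x, e s with hEdef
  set G : ℝ → ℝ := fun t => γ * e t + c * E t - K with hG
  have hGab : ContinuousOn G (Icc a b) := by fun_prop
  have hGc : ContinuousOn G (Icc l r) := hGab.mono hsub
  have hQc : ContinuousOn (Q 0) (Icc l r) := fun t ht =>
    (hQ 0 (by omega) t ht).continuousWithinAt
  have hqc : ContinuousOn (fun t => q.eval t) (Icc l r) := q.continuous.continuousOn
  have hDc : ContinuousOn (fun t => Q 0 t - q.eval t) (Icc l r) := hQc.sub hqc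
  have hDGc : ContinuousOn (fun t => |Q 0 t - q.eval t - G t|) (Icc l r) := (hDc.sub hGc).abs
  set μ : ℝ := ∫ t in l..r, w t with hμ
  have hμ0 : 0 ≤ μ := hw.integral_nonneg hlr.le
  have hμh : μ ≤ w₁ * h := (hw.integral_le hlr.le).trans
    (mul_le_mul_of_nonneg_left hh hw.upper_pos.le)
  have hΓ0 : 0 ≤ Γ := (abs_nonneg _).trans (hΓ a ha')
  have hε0 : 0 ≤ ε := (abs_nonneg _).trans (hε a ha')
  obtain ⟨t₀, ht₀, hmax⟩ := isCompact_Icc.exists_isMaxOn ⟨l, hl⟩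
    (f := fun t => |G t - G l|) (by fun_prop)
  set ω' : ℝ := |G t₀ - G l| with hω'
  have hosc : ∀ t ∈ Icc l r, |G t - G l| ≤ ω' := fun t ht => hmax ht
  have htaylor : ∀ n ≤ p, ∃ T : Polynomial ℝ, T.natDegree ≤ n ∧
      ∀ t ∈ Icc l r, |Q 0 t - T.eval t| ≤ M * h ^ (n + 1) := by
    intro n hn
    obtain ⟨T, hT, hTb⟩ := exists_taylor_polynomial hlr.le n Q (fun j hj => hQ j (hj.trans hn))
      (hQM (n + 1) (by omega))
    refine ⟨T, hT, fun t ht => (hTb t ht).trans (mul_le_mul_of_nonneg_left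
      (pow_le_pow_left₀ (sub_nonneg.2 ht.1) (by linarith [ht.2]) _) hM0.le)⟩
  obtain ⟨T, hT, hTb⟩ := htaylor (p - 1) (by omega)
  rw [show p - 1 + 1 = p by omega] at hTb
  have h1 := (element_estimate hp hw hlr.le (by positivity) hA hg hq hT hqd hQc hTb hGc hosc
    hcol).1 le_rfl
  obtain ⟨T', hT', hTb'⟩ := htaylor p le_rfl
  have h2 := (element_estimate hp hw hlr.le (by positivity) hA hg hq hT' hqd hQc hTb' hGc hosc
    hcol).2 le_rfl
  have hωω : ω' ≤ ω := by
    have hFTC := hw.sub_eq_integral (he.mono hsub) hDc hder ht₀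
    have h3 : |e t₀ - e l| ≤ (2 * (M * h ^ p + ω') + Γ) * μ := by
      rw [hFTC]
      refine (hw.abs_integral_mul_le_of_subinterval hDc ht₀).trans ?_
      have h4 := hw.integral_abs_mul_le hlr.le hGc (fun t ht => hΓ t (hsub ht))
      have h5 := intervalIntegral.integral_mono_on hlr.le
        (f := fun t => |Q 0 t - q.eval t| * w t)
        (g := fun t => |Q 0 t - q.eval t - G t| * w t + |G t| * w t)
        (hw.intervalIntegrable_mul hDc.abs hl hr)
        ((hw.intervalIntegrable_mul hDGc hl hr).add
          (hw.intervalIntegrable_mul hGc.abs hl hr)) (fun t _ => by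
          rw [← add_mul]
          refine mul_le_mul_of_nonneg_right ?_ (hw.nonneg t)
          simpa using abs_add_le (Q 0 t - q.eval t - G t) (G t))
      rw [intervalIntegral.integral_add
        (hw.intervalIntegrable_mul hDGc hl hr)
        (hw.intervalIntegrable_mul hGc.abs hl hr)] at h5
      rw [add_mul]
      exact h5.trans (add_le_add h1 h4)
    have h6 : |E t₀ - E l| ≤ ε * h := by
      have h7 : E t₀ - E l = ∫ s in l..t₀, e s := intervalIntegral.integral_interval_sub_left
        (he.intervalIntegrable_sub ha' (hsub ht₀)) (he.intervalIntegrable_sub ha' (hsub hl))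
      rw [h7, ← Real.norm_eq_abs]
      refine (intervalIntegral.norm_integral_le_of_norm_le_const (C := ε) (fun t ht => ?_)).trans
        (mul_le_mul_of_nonneg_left ?_ hε0)
      · rw [uIoc_of_le ht₀.1] at ht
        exact hε t (hsub ⟨ht.1.le, ht.2.trans ht₀.2⟩)
      · rw [abs_of_nonneg (sub_nonneg.2 ht₀.1)]; linarith [ht₀.2]
    have h8 : ω' ≤ |γ| * |e t₀ - e l| + c * |E t₀ - E l| := by
      have h9 : G t₀ - G l = γ * (e t₀ - e l) + c * (E t₀ - E l) := by simp only [hG]; ring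
      rw [hω', h9]
      refine (abs_add_le _ _).trans (le_of_eq ?_)
      rw [abs_mul, abs_mul, abs_of_pos hc]
    have hω0 : 0 ≤ ω' := abs_nonneg _
    have h10 : (2 * (M * h ^ p + ω') + Γ) * μ ≤ (2 * (M * h ^ p + ω') + Γ) * (w₁ * h) :=
      mul_le_mul_of_nonneg_left hμh (by positivity)
    have h11 := mul_le_mul_of_nonneg_left (h3.trans h10) (abs_nonneg γ)
    have h12 := mul_le_mul_of_nonneg_left h6 hc.le
    have h13 := mul_le_mul_of_nonneg_right hsmall hω0
    rw [hωdef]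
    nlinarith
  refine ⟨h1.trans ?_, h2.trans ?_⟩ <;>
  exact mul_le_mul_of_nonneg_right (by linarith) hμ0

section Partition

variable {x : ℕ → ℝ} {N : ℕ}

theorem partition_le (hx : ∀ i, i < N → x i < x (i + 1)) {i j : ℕ} (hij : i ≤ j) (hj : j ≤ N) :
    x i ≤ x j := by
  induction j, hij using Nat.le_induction with
  | base => exact le_rfl
  | succ n hn ih => exact (ih (by omega)).trans (hx n (by omega)).le

theorem exists_mem_partition_Icc {t : ℝ} (hN : 1 ≤ N) (h0 : x 0 ≤ t) (h1 : t ≤ x N) :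
    ∃ i < N, t ∈ Icc (x i) (x (i + 1)) := by
  induction N, hN using Nat.le_induction with
  | base => exact ⟨0, by omega, h0, h1⟩
  | succ n hn ih =>
    rcases le_total t (x n) with h | h
    · obtain ⟨i, hi, hti⟩ := ih h
      exact ⟨i, by omega, hti⟩
    · exact ⟨n, by omega, h, h1⟩

end Partition

/-- Uniform error bound of order `p + 1` for the Gauss collocation form of the scheme. The
function `e` is the error, `Q` the chain of derivatives of the exact flux and `q i` the discrete
flux on the `i`-th element. -/
theorem exists_collocation_error_const (p : ℕ) (hp : 2 ≤ p) (w₀ w₁ γ c d : ℝ) (hw₀ : 0 < w₀)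
    (hw₁ : 0 < w₁) (hc : 0 < c) (hd : 0 < d) :
    ∃ h₀ C : ℝ, 0 < h₀ ∧ 0 < C ∧
      ∀ (N : ℕ) (a b α h K M : ℝ) (x : ℕ → ℝ) (g A : ℕ → ℕ → ℝ) (w e : ℝ → ℝ)
        (Q : ℕ → ℝ → ℝ) (q : ℕ → Polynomial ℝ),
      IsWeight w α w₀ w₁ → b - a = d → 1 ≤ N → x 0 = a → x N = b →
      (∀ i, i < N → x i < x (i + 1)) → (∀ i < N, x (i + 1) - x i ≤ h) → h ≤ h₀ → 0 < M →
      (∀ i < N, ∀ j ∈ Finset.Icc 1 p, 0 < A (i + 1) j) →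
      (∀ i < N, ∀ j ∈ Finset.Icc 1 p, g (i + 1) j ∈ Icc (x i) (x (i + 1))) →
      (∀ i < N, ∀ F : Polynomial ℝ, F.natDegree ≤ 2 * p - 1 →
        ∑ j ∈ Finset.Icc 1 p, A (i + 1) j * F.eval (g (i + 1) j)
          = ∫ t in (x i)..(x (i + 1)), F.eval t * w t) →
      (∀ i < N, (q (i + 1)).natDegree ≤ p - 1) →
      (∀ j ≤ p, ∀ t ∈ Icc a b, HasDerivWithinAt (Q j) (Q (j + 1) t) (Icc a b) t) →
      (∀ j ≤ p + 1, ∀ t ∈ Icc a b, |Q j t| ≤ M) →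
      ContinuousOn e (Icc a b) → e a = 0 → e b = 0 →
      (∀ i < N, ∀ t ∈ Ioo (x i) (x (i + 1)), t ≠ α →
        HasDerivAt e ((Q 0 t - (q (i + 1)).eval t) * w t) t) →
      (∀ i < N, ∀ j ∈ Finset.Icc 1 p, Q 0 (g (i + 1) j) - (q (i + 1)).eval (g (i + 1) j)
        = γ * e (g (i + 1) j) + c * (∫ s in a..(g (i + 1) j), e s) - K) →
      ∀ t ∈ Icc a b, |e t| ≤ C * h ^ (p + 1) * M := by
  obtain ⟨Cs, hCs, hstab⟩ := exists_stability_const w₀ w₁ γ c d hw₀ hw₁ hc hd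
  set C₂ : ℝ := (|γ| + c * d + 1) * Cs with hC₂
  set C₃ : ℝ := 2 * (|γ| * w₁ * C₂ + c * Cs) with hC₃
  set C₄ : ℝ := 2 * w₁ * (d + 1) with hC₄
  have hC₂0 : 0 < C₂ := by positivity
  have hC₃0 : 0 < C₃ := by positivity
  have hC₄0 : 0 < C₄ := by positivity
  refine ⟨1 / (1 + 4 * |γ| * w₁ + 2 * C₄ * C₃), Cs * (2 * (C₄ * (1 + 4 * |γ| * w₁) + 1)),
    by positivity, by positivity, ?_⟩
  intro N a b α h K M x g A w e Q q hw hab' hN hx0 hxN hx hxh hh₀ hM hA hg hq hqd hQ hQM he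
    hea heb hder hcol
  have hab : a < b := by linarith
  have ha' : a ∈ Icc a b := left_mem_Icc.2 hab.le
  have hb' : b ∈ Icc a b := right_mem_Icc.2 hab.le
  have h0 : 0 < h := by
    have := hx 0 (by omega); have := hxh 0 (by omega); linarith
  rw [le_div_iff₀ (by positivity)] at hh₀
  have hγ0 : 0 ≤ |γ| * w₁ * h := by positivity
  have hC0 : 0 ≤ C₄ * C₃ * h := by positivity
  have hh1 : h ≤ 1 := by linarith
  have hhγ : 4 * |γ| * w₁ * h ≤ 1 := by linarith
  have hhC : C₄ * C₃ * h ≤ 1 / 2 := by linarith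
  have heI := he.intervalIntegrable_sub ha' hb'
  have hE : ContinuousOn (fun x => ∫ s in a..x, e s) (Icc a b) :=
    continuousOn_primitive_Icc hab.le heI
  set G : ℝ → ℝ := fun t => γ * e t + c * (∫ s in a..t, e s) - K with hG
  have hGc : ContinuousOn G (Icc a b) := by fun_prop
  set P : ℝ → ℝ := fun y => e y - ∫ t in a..y, G t * w t with hP
  have hPc : ContinuousOn P (Icc a b) :=
    he.sub (continuousOn_primitive_Icc hab.le (hw.intervalIntegrable_mul hGc ha' hb'))
  obtain ⟨t₀, ht₀, hmax⟩ := isCompact_Icc.exists_isMaxOn ⟨a, ha'⟩ (f := fun t => |P t|)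
    (by fun_prop)
  have hPm : ∀ t ∈ Icc a b, |P t| ≤ |P t₀| := fun t ht => hmax ht
  set m : ℝ := |P t₀| + M * h ^ (p + 1) with hm
  have hMh : 0 < M * h ^ (p + 1) := by positivity
  have hm0 : 0 < m := by positivity
  obtain ⟨hem, hKm⟩ := hstab w e α a b K m hw hab' hm0 he heb
    (fun y hy => (hPm y hy).trans (by linarith))
  have hGm : ∀ t ∈ Icc a b, |G t| ≤ C₂ * m := by
    intro t ht
    have h1 := intervalIntegral.norm_integral_le_of_norm_le_const (a := a) (b := t) (f := e)
      (C := Cs * m) (fun s hs => by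
        rw [uIoc_of_le ht.1] at hs
        exact hem s ⟨hs.1.le, hs.2.trans ht.2⟩)
    rw [Real.norm_eq_abs, abs_of_nonneg (sub_nonneg.2 ht.1)] at h1
    have h2 : |∫ s in a..t, e s| ≤ Cs * m * d :=
      h1.trans (mul_le_mul_of_nonneg_left (by linarith [ht.2]) (by positivity))
    have h3 := mul_le_mul_of_nonneg_left (hem t ht) (abs_nonneg γ)
    have h4 := mul_le_mul_of_nonneg_left h2 hc.le
    have h5 : |G t| ≤ |γ| * |e t| + c * |∫ s in a..t, e s| + |K| := by
      refine (abs_sub _ _).trans (add_le_add ((abs_add_le _ _).trans (le_of_eq ?_)) le_rfl)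
      rw [abs_mul, abs_mul, abs_of_pos hc]
    rw [hC₂]; linarith
  set ω : ℝ := 2 * h * (|γ| * w₁ * (2 * (M * h ^ p) + C₂ * m) + c * (Cs * m)) with hω
  have hω0 : 0 ≤ ω := by positivity
  have hωeq : ω = 4 * |γ| * w₁ * (M * h ^ (p + 1)) + C₃ * h * m := by
    rw [hω, hC₃]; ring
  have hmem : ∀ i ≤ N, x i ∈ Icc a b := fun i hi =>
    ⟨hx0 ▸ partition_le hx (Nat.zero_le i) hi, hxN ▸ partition_le hx hi le_rfl⟩
  have hsubi : ∀ i < N, Icc (x i) (x (i + 1)) ⊆ Icc a b := fun i hi =>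
    Icc_subset_Icc (hmem i hi.le).1 (hmem (i + 1) hi).2
  have hbd := fun (i : ℕ) (hi : i < N) => element_defect_bounds (γ := γ) (c := c) (K := K) hp hw
    hc (hx i hi) (hmem i hi.le).1 (hmem (i + 1) hi).2 (hxh i hi) hhγ hM (hA i hi) (hg i hi)
    (hq i hi) (hqd i hi)
    (fun j hj t ht => (hQ j hj t (hsubi i hi ht)).mono (hsubi i hi))
    (fun j hj t ht => hQM j hj t (hsubi i hi ht)) he (hder i hi) hGm hem (hcol i hi) hω
  have hDc : ∀ i < N, ContinuousOn (fun t => Q 0 t - (q (i + 1)).eval t) (Icc (x i) (x (i + 1))) :=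
    fun i hi => ContinuousOn.sub
      (fun t ht => ((hQ 0 (by omega) t (hsubi i hi ht)).mono (hsubi i hi)).continuousWithinAt)
      (q (i + 1)).continuous.continuousOn
  have hstep : ∀ i < N, ∀ y ∈ Icc (x i) (x (i + 1)),
      P y - P (x i) = ∫ t in (x i)..y, (Q 0 t - (q (i + 1)).eval t - G t) * w t := by
    intro i hi y hy
    have hl : x i ∈ Icc (x i) (x (i + 1)) := left_mem_Icc.2 (hx i hi).le
    have h1 := hw.sub_eq_integral (he.mono (hsubi i hi)) (hDc i hi) (hder i hi) hy
    have h2 := intervalIntegral.integral_interval_sub_left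
      (hw.intervalIntegrable_mul hGc ha' (hsubi i hi hy))
      (hw.intervalIntegrable_mul hGc ha' (hsubi i hi hl))
    simp only [sub_mul] at h1 ⊢
    simp only [← sub_mul]
    have h3 := intervalIntegral.integral_sub
      (hw.intervalIntegrable_mul (hDc i hi) hl hy)
      (hw.intervalIntegrable_mul hGc (hsubi i hi hl) (hsubi i hi hy))
    simp only [← sub_mul] at h3 h1
    rw [h3, ← h1, ← h2]
    simp only [hP]; ring
  have hPa : P a = 0 := by simp [hP, hea]
  have hnode : ∀ i ≤ N, |P (x i)| ≤ 2 * (M * h ^ (p + 1) + ω) * ∫ t in a..(x i), w t := by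
    intro i
    induction i with
    | zero => intro _; simp [hx0, hPa]
    | succ i ih =>
      intro hi
      have h1 := ih (by omega)
      have h2 := (hbd i hi).2
      have h3 := hstep i hi _ (right_mem_Icc.2 (hx i hi).le)
      have h4 := intervalIntegral.integral_add_adjacent_intervals
        (hw.intervalIntegrable a (x i)) (hw.intervalIntegrable (x i) (x (i + 1)))
      rw [← h3] at h2
      rw [← h4, mul_add]
      have h5 : |P (x (i + 1))| ≤ |P (x i)| + |P (x (i + 1)) - P (x i)| := by
        simpa using abs_add_le (P (x i)) (P (x (i + 1)) - P (x i))
      linarith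
  have hPall : |P t₀| ≤ C₄ * (M * h ^ (p + 1) + ω) := by
    obtain ⟨i, hi, hti⟩ := exists_mem_partition_Icc (x := x) hN (hx0 ▸ ht₀.1) (hxN ▸ ht₀.2)
    have h1 := hnode i hi.le
    have h2 : |P t₀ - P (x i)| ≤ 2 * (M * h ^ p + ω) * ∫ t in (x i)..(x (i + 1)), w t := by
      rw [hstep i hi t₀ hti]
      exact (hw.abs_integral_mul_le_of_subinterval
        ((hDc i hi).sub (hGc.mono (hsubi i hi))) hti).trans (hbd i hi).1
    have h3 : |P t₀| ≤ |P (x i)| + |P t₀ - P (x i)| := by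
      simpa using abs_add_le (P (x i)) (P t₀ - P (x i))
    have h4 : ∫ t in a..(x i), w t ≤ w₁ * d := (hw.integral_le (hmem i hi.le).1).trans
      (mul_le_mul_of_nonneg_left (by linarith [(hmem i hi.le).2]) hw₁.le)
    have h5 : ∫ t in (x i)..(x (i + 1)), w t ≤ w₁ * h := (hw.integral_le (hx i hi).le).trans
      (mul_le_mul_of_nonneg_left (hxh i hi) hw₁.le)
    have h6 := mul_le_mul_of_nonneg_left h4 (by positivity : 0 ≤ 2 * (M * h ^ (p + 1) + ω))
    have h7 := mul_le_mul_of_nonneg_left h5 (by positivity : 0 ≤ 2 * (M * h ^ p + ω))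
    have h8 : 2 * (M * h ^ p + ω) * (w₁ * h) ≤ 2 * w₁ * (M * h ^ (p + 1) + ω) := by
      have := mul_le_mul_of_nonneg_left hh1 (by positivity : 0 ≤ 2 * w₁ * ω)
      rw [pow_succ]; linarith
    rw [hC₄]; linarith
  have hmbound : m ≤ 2 * (C₄ * (1 + 4 * |γ| * w₁) + 1) * (M * h ^ (p + 1)) := by
    have h1 := mul_le_mul_of_nonneg_right hhC hm0.le
    rw [hωeq] at hPall
    have h2 : m ≤ C₄ * (M * h ^ (p + 1) + (4 * |γ| * w₁ * (M * h ^ (p + 1)) + C₃ * h * m))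
      + M * h ^ (p + 1) := by rw [hm]; linarith
    linarith
  intro t ht
  refine (hem t ht).trans ((mul_le_mul_of_nonneg_left hmbound hCs.le).trans (le_of_eq (by ring)))

theorem isWeight_inv_betaPW {βm βp : ℝ} (hβm : 0 < βm) (hβp : 0 < βp) (α : ℝ) :
    IsWeight (fun t => (betaPW βm βp α t)⁻¹) α (min βm⁻¹ βp⁻¹) (max βm⁻¹ βp⁻¹) where
  measurable := (Measurable.ite measurableSet_Iio measurable_const measurable_const).inv
  pos := lt_min (inv_pos.2 hβm) (inv_pos.2 hβp)
  lower t := by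
    unfold betaPW
    split_ifs
    exacts [min_le_left _ _, min_le_right _ _]
  upper t := by
    unfold betaPW
    split_ifs
    exacts [le_max_left _ _, le_max_right _ _]
  continuousAt t ht := by
    rcases lt_or_gt_of_ne ht with h | h
    · refine (continuousAt_const (y := βm⁻¹)).congr ?_
      filter_upwards [Iio_mem_nhds h] with s hs
      simp [betaPW, mem_Iio.1 hs]
    · refine (continuousAt_const (y := βp⁻¹)).congr ?_
      filter_upwards [Ioi_mem_nhds h] with s hs
      simp [betaPW, not_lt.2 (mem_Ioi.1 hs).le]

theorem betaPW_pos {βm βp : ℝ} (hβm : 0 < βm) (hβp : 0 < βp) (α t : ℝ) :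
    0 < betaPW βm βp α t := by
  unfold betaPW
  split_ifs <;> assumption

/-- The `j`-th derivative of the flux `β u'`, extended through the interface. -/
noncomputable def fluxDeriv (βm βp a b α : ℝ) (u : ℝ → ℝ) (j : ℕ) (t : ℝ) : ℝ :=
  if t ≤ α then βm * iteratedDerivWithin (j + 1) u (Icc a α) t
  else βp * iteratedDerivWithin (j + 1) u (Icc α b) t

section Flux

variable {βm βp a b α : ℝ} {u : ℝ → ℝ} {n j : ℕ} {t : ℝ}

theorem fluxDeriv_of_le (ht : t ≤ α) :
    fluxDeriv βm βp a b α u j t = βm * iteratedDerivWithin (j + 1) u (Icc a α) t :=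
  if_pos ht

theorem fluxDeriv_of_ge (hu : MemW n a b α βm βp u) (hj : j + 1 ≤ n) (ht : α ≤ t) :
    fluxDeriv βm βp a b α u j t = βp * iteratedDerivWithin (j + 1) u (Icc α b) t := by
  rcases ht.eq_or_lt with rfl | h
  · rw [fluxDeriv_of_le le_rfl]
    exact hu.2.2.2.2.2 (j + 1) (by omega) hj
  · exact if_neg (not_le.2 h)

theorem ContDiffOn.hasDerivWithinAt_iteratedDerivWithin {y z : ℝ} (hyz : y < z)
    (hu : ContDiffOn ℝ (n : ℕ∞) u (Icc y z)) (hj : j < n) (ht : t ∈ Icc y z) :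
    HasDerivWithinAt (iteratedDerivWithin j u (Icc y z))
      (iteratedDerivWithin (j + 1) u (Icc y z) t) (Icc y z) t := by
  rw [iteratedDerivWithin_succ]
  exact (hu.differentiableOn_iteratedDerivWithin (by exact_mod_cast hj)
    (uniqueDiffOn_Icc hyz) t ht).hasDerivWithinAt

theorem hasDerivWithinAt_fluxDeriv (haα : a < α) (hαb : α < b) (hu : MemW n a b α βm βp u)
    (hj : j + 1 < n) (ht : t ∈ Icc a b) :
    HasDerivWithinAt (fluxDeriv βm βp a b α u j) (fluxDeriv βm βp a b α u (j + 1) t)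
      (Icc a b) t := by
  rw [← Icc_union_Icc_eq_Icc haα.le hαb.le]
  refine HasDerivWithinAt.union ?_ ?_
  · by_cases h : t ≤ α
    · rw [fluxDeriv_of_le h]
      exact ((hu.2.2.2.1.hasDerivWithinAt_iteratedDerivWithin haα hj ⟨ht.1, h⟩).const_mul βm).congr
        (fun s hs => fluxDeriv_of_le hs.2) (fluxDeriv_of_le h)
    · exact HasFDerivWithinAt.of_notMem_closure (by rw [closure_Icc]; exact fun hs => h hs.2)
  · by_cases h : α ≤ t
    · rw [fluxDeriv_of_ge hu (by omega) h]
      exact ((hu.2.2.2.2.1.hasDerivWithinAt_iteratedDerivWithin hαb hj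
        ⟨h, ht.2⟩).const_mul βp).congr
        (fun s hs => fluxDeriv_of_ge hu (by omega) hs.1) (fluxDeriv_of_ge hu (by omega) h)
    · exact HasFDerivWithinAt.of_notMem_closure (by rw [closure_Icc]; exact fun hs => h hs.1)

theorem hasDerivAt_of_memW (hβm : 0 < βm) (hβp : 0 < βp) (hu : MemW n a b α βm βp u)
    (hn : 1 ≤ n) (ht : t ∈ Ioo a b) (htα : t ≠ α) :
    HasDerivAt u (fluxDeriv βm βp a b α u 0 t * (betaPW βm βp α t)⁻¹) t := by
  rcases lt_or_gt_of_ne htα with h | h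
  · rw [fluxDeriv_of_le h.le, betaPW, if_pos h, mul_comm βm, mul_inv_cancel_right₀ hβm.ne']
    have := hu.2.2.2.1.hasDerivWithinAt_iteratedDerivWithin (j := 0) (ht.1.trans h) (by omega)
      ⟨ht.1.le, h.le⟩
    rw [iteratedDerivWithin_zero] at this
    exact this.hasDerivAt (Icc_mem_nhds ht.1 h)
  · rw [fluxDeriv_of_ge hu hn h.le, betaPW, if_neg (not_lt.2 h.le), mul_comm βp,
      mul_inv_cancel_right₀ hβp.ne']
    have := hu.2.2.2.2.1.hasDerivWithinAt_iteratedDerivWithin (j := 0) (h.trans ht.2) (by omega)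
      ⟨h.le, ht.2.le⟩
    rw [iteratedDerivWithin_zero] at this
    exact this.hasDerivAt (Icc_mem_nhds h ht.2)

theorem betaPW_mul_iteratedDeriv_two (hβm : 0 < βm) (hβp : 0 < βp) (haα : a < α) (hαb : α < b)
    (hu : MemW n a b α βm βp u) (hn : 2 ≤ n) (ht : t ∈ Ioo a b) (htα : t ≠ α) :
    betaPW βm βp α t * iteratedDeriv 2 u t = fluxDeriv βm βp a b α u 1 t := by
  have hβ : ∀ᶠ s in nhds t, betaPW βm βp α s = betaPW βm βp α t := by
    rcases lt_or_gt_of_ne htα with h | h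
    · filter_upwards [Iio_mem_nhds h] with s hs
      simp [betaPW, mem_Iio.1 hs, h]
    · filter_upwards [Ioi_mem_nhds h] with s hs
      simp [betaPW, not_lt.2 (mem_Ioi.1 hs).le, not_lt.2 h.le]
  have hd : HasDerivAt (deriv u)
      (fluxDeriv βm βp a b α u 1 t * (betaPW βm βp α t)⁻¹) t := by
    have h1 := ((hasDerivWithinAt_fluxDeriv haα hαb hu (j := 0) (by omega)
      ⟨ht.1.le, ht.2.le⟩).hasDerivAt (Icc_mem_nhds ht.1 ht.2)).mul_const (betaPW βm βp α t)⁻¹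
    refine h1.congr_of_eventuallyEq ?_
    filter_upwards [hβ, Ioo_mem_nhds ht.1 ht.2, isOpen_ne.mem_nhds htα] with s hs hs1 hs2
    rw [(hasDerivAt_of_memW hβm hβp hu (by omega) hs1 hs2).deriv, hs]
  rw [iteratedDeriv_succ, iteratedDeriv_one, hd.deriv, mul_comm,
    inv_mul_cancel_right₀ (betaPW_pos hβm hβp α t).ne']

theorem bddAbove_iteratedDerivWithin {y z : ℝ} (hyz : y < z)
    (hu : ContDiffOn ℝ (n : ℕ∞) u (Icc y z)) :
    BddAbove {s : ℝ | ∃ j ≤ n, ∃ t ∈ Icc y z, s = |iteratedDerivWithin j u (Icc y z) t|} := by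
  have h : {s : ℝ | ∃ j ≤ n, ∃ t ∈ Icc y z, s = |iteratedDerivWithin j u (Icc y z) t|} =
      ⋃ j ∈ Iic n, (fun t => |iteratedDerivWithin j u (Icc y z) t|) '' Icc y z := by
    ext s
    simp [eq_comm]
  rw [h, (finite_Iic n).bddAbove_biUnion]
  intro j hj
  exact isCompact_Icc.bddAbove_image (hu.continuousOn_iteratedDerivWithin
    (by exact_mod_cast hj) (uniqueDiffOn_Icc hyz)).abs

theorem abs_fluxDeriv_le (hβm : 0 < βm) (hβp : 0 < βp) (haα : a < α) (hαb : α < b)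
    (hu : MemW n a b α βm βp u) (hj : j + 1 ≤ n) (ht : t ∈ Icc a b) :
    |fluxDeriv βm βp a b α u j t| ≤ max βm βp * wnorm n a b α u := by
  have hβ : 0 ≤ max βm βp := hβm.le.trans (le_max_left _ _)
  rcases le_total t α with h | h
  · rw [fluxDeriv_of_le h, abs_mul, abs_of_pos hβm]
    refine mul_le_mul (le_max_left _ _) (le_trans ?_ (le_max_left _ _)) (abs_nonneg _) hβ
    exact le_csSup (bddAbove_iteratedDerivWithin haα hu.2.2.2.1) ⟨j + 1, hj, t, ⟨ht.1, h⟩, rfl⟩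
  · rw [fluxDeriv_of_ge hu hj h, abs_mul, abs_of_pos hβp]
    refine mul_le_mul (le_max_right _ _) (le_trans ?_ (le_max_right _ _)) (abs_nonneg _) hβ
    exact le_csSup (bddAbove_iteratedDerivWithin hαb hu.2.2.2.2.1) ⟨j + 1, hj, t, ⟨h, ht.2⟩, rfl⟩

/-- The integrated form of the differential equation. -/
theorem integral_source_eq (hβm : 0 < βm) (hβp : 0 < βp) (haα : a < α) (hαb : α < b)
    (hu : MemW n a b α βm βp u) (hn : 3 ≤ n) {γ c : ℝ} {f : ℝ → ℝ}
    (hf : ∀ t, t ∈ Ioo a α ∪ Ioo α b →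
      -(betaPW βm βp α t * iteratedDeriv 2 u t) + γ * deriv u t + c * u t = f t)
    {y z : ℝ} (hay : a < y) (hyz : y ≤ z) (hzb : z < b) :
    ∫ t in y..z, f t = fluxDeriv βm βp a b α u 0 y - fluxDeriv βm βp a b α u 0 z
      + γ * (u z - u y) + c * ∫ t in y..z, u t := by
  set w : ℝ → ℝ := fun t => (betaPW βm βp α t)⁻¹ with hwdef
  have hw : IsWeight w α (min βm⁻¹ βp⁻¹) (max βm⁻¹ βp⁻¹) := isWeight_inv_betaPW hβm hβp α
  set Q := fluxDeriv βm βp a b α u with hQ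
  have hd : ∀ j, j + 1 < n → ∀ t ∈ Icc a b, HasDerivWithinAt (Q j) (Q (j + 1) t) (Icc a b) t :=
    fun j hj t ht => hasDerivWithinAt_fluxDeriv haα hαb hu hj ht
  have hQc : ∀ j, j + 1 < n → ContinuousOn (Q j) (Icc a b) := fun j hj t ht =>
    (hd j hj t ht).continuousWithinAt
  have hsub : Icc y z ⊆ Icc a b := Icc_subset_Icc hay.le hzb.le
  have hy : y ∈ Icc y z := left_mem_Icc.2 hyz
  have hz : z ∈ Icc y z := right_mem_Icc.2 hyz
  have hfeq : ∫ t in y..z, f t = ∫ t in y..z, (-Q 1 t + γ * (Q 0 t * w t) + c * u t) := by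
    refine intervalIntegral.integral_congr_ae ?_
    filter_upwards [MeasureTheory.compl_mem_ae_iff.2 (MeasureTheory.measure_singleton α)] with t htα ht
    rw [uIoc_of_le hyz] at ht
    have ht' : t ∈ Ioo a b := ⟨hay.trans ht.1, ht.2.trans_lt hzb⟩
    have htα' : t ≠ α := htα
    rw [← hf t (by
        rcases lt_or_gt_of_ne htα' with h | h
        · exact Or.inl ⟨ht'.1, h⟩
        · exact Or.inr ⟨h, ht'.2⟩), betaPW_mul_iteratedDeriv_two hβm hβp haα hαb hu (by omega) ht'
      htα', (hasDerivAt_of_memW hβm hβp hu (by omega) ht' htα').deriv]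
  have hI1 := (hQc 1 (by omega)).intervalIntegrable_sub (hsub hy) (hsub hz)
  have hI1n : IntervalIntegrable (fun t => -Q 1 t) MeasureTheory.volume y z := hI1.neg
  have hI0 := hw.intervalIntegrable_mul (hQc 0 (by omega)) (hsub hy) (hsub hz)
  have hIu := hu.1.intervalIntegrable_sub (hsub hy) (hsub hz)
  have h1 : ∫ t in y..z, Q 1 t = Q 0 z - Q 0 y :=
    intervalIntegral.integral_eq_sub_of_hasDerivAt_of_le hyz ((hQc 0 (by omega)).mono hsub)
      (fun t ht => (hd 0 (by omega) t (hsub (Ioo_subset_Icc_self ht))).hasDerivAt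
        (Icc_mem_nhds (hay.trans ht.1) (ht.2.trans hzb))) hI1
  have h2 := hw.sub_eq_integral (hu.1.mono hsub) ((hQc 0 (by omega)).mono hsub)
    (fun t ht htα => hasDerivAt_of_memW hβm hβp hu (by omega)
      ⟨hay.trans ht.1, ht.2.trans hzb⟩ htα) hz
  rw [hfeq, intervalIntegral.integral_add (hI1n.add (hI0.const_mul γ)) (hIu.const_mul c),
    intervalIntegral.integral_add hI1n (hI0.const_mul γ), intervalIntegral.integral_neg,
    intervalIntegral.integral_const_mul, intervalIntegral.integral_const_mul, ← h2, h1]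
  ring

end Flux

theorem Polynomial.eq_of_eval_iterate_derivative_eq {P R : Polynomial ℝ} {n : ℕ} {α : ℝ}
    (hP : P.natDegree ≤ n) (hR : R.natDegree ≤ n)
    (h : ∀ j ≤ n, ((⇑Polynomial.derivative)^[j] P).eval α
      = ((⇑Polynomial.derivative)^[j] R).eval α) : P = R := by
  by_contra hne
  have hD : P - R ≠ 0 := sub_ne_zero.2 hne
  have h1 : n < (P - R).rootMultiplicity α := by
    refine Polynomial.lt_rootMultiplicity_of_isRoot_iterate_derivative hD fun m hm => ?_
    rw [Polynomial.IsRoot.def, Polynomial.iterate_derivative_sub, Polynomial.eval_sub, h m hm,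
      sub_self]
  have h2 : (P - R).rootMultiplicity α ≤ (P - R).natDegree := by
    have := Polynomial.natDegree_le_of_dvd ((P - R).pow_rootMultiplicity_dvd α) hD
    rwa [Polynomial.natDegree_pow, Polynomial.natDegree_X_sub_C, mul_one] at this
  have h3 := Polynomial.natDegree_sub_le_of_le hP hR
  rw [max_self] at h3
  omega

section TrialSpace

variable {p N k : ℕ} {a b α βm βp : ℝ} {x : ℕ → ℝ} {v : ℝ → ℝ}

theorem Polynomial.natDegree_C_mul_derivative_le {q : Polynomial ℝ} (hq : q.natDegree ≤ p)
    (s : ℝ) : (Polynomial.C s * Polynomial.derivative q).natDegree ≤ p - 1 :=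
  (Polynomial.natDegree_C_mul_le _ _).trans
    ((Polynomial.natDegree_derivative_le q).trans (Nat.sub_le_sub_right hq 1))

theorem Polynomial.hasDerivAt_of_eqOn_Icc {q : Polynomial ℝ} {y z t s : ℝ}
    (hv : ∀ τ ∈ Icc y z, v τ = q.eval τ) (ht : t ∈ Ioo y z) (hs : 0 < s) :
    HasDerivAt v ((Polynomial.C s * Polynomial.derivative q).eval t * s⁻¹) t := by
  rw [Polynomial.eval_C_mul, mul_comm s, mul_inv_cancel_right₀ hs.ne']
  refine (q.hasDerivAt t).congr_of_eventuallyEq ?_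
  filter_upwards [Icc_mem_nhds ht.1 ht.2] with τ hτ using hv τ hτ

/-- On every element the flux of a trial function is a single polynomial. -/
theorem MemUT.exists_flux_polynomial (hp : 1 ≤ p) (hβm : 0 < βm) (hβp : 0 < βp)
    (hx : ∀ i, i < N → x i < x (i + 1)) (hk : 1 ≤ k) (hkN : k ≤ N) (hkl : x (k - 1) < α)
    (hkr : α < x k) (hv : MemUT p N k a b α βm βp x v) {i : ℕ} (hi : i < N) :
    ∃ q : Polynomial ℝ, q.natDegree ≤ p - 1 ∧ ∀ t ∈ Ioo (x i) (x (i + 1)), t ≠ α →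
      HasDerivAt v (q.eval t * (betaPW βm βp α t)⁻¹) t := by
  obtain ⟨-, -, -, hreg, qm, qp, hqm, hqp, hvm, hvp, hjump⟩ := hv
  rcases eq_or_ne (i + 1) k with rfl | hik
  · have hq : Polynomial.C βm * Polynomial.derivative qm
        = Polynomial.C βp * Polynomial.derivative qp := by
      refine Polynomial.eq_of_eval_iterate_derivative_eq (α := α)
        (Polynomial.natDegree_C_mul_derivative_le hqm βm)
        (Polynomial.natDegree_C_mul_derivative_le hqp βp) fun j hj => ?_
      rw [Polynomial.iterate_derivative_C_mul, Polynomial.iterate_derivative_C_mul,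
        Polynomial.eval_C_mul, Polynomial.eval_C_mul, ← Function.iterate_succ_apply,
        ← Function.iterate_succ_apply]
      exact hjump (j + 1) (by omega) (by omega)
    refine ⟨_, Polynomial.natDegree_C_mul_derivative_le hqm βm, fun t ht htα => ?_⟩
    rcases lt_or_gt_of_ne htα with h | h
    · rw [betaPW, if_pos h]
      exact Polynomial.hasDerivAt_of_eqOn_Icc hvm ⟨ht.1, h⟩ hβm
    · rw [betaPW, if_neg (not_lt.2 h.le), hq]
      exact Polynomial.hasDerivAt_of_eqOn_Icc hvp ⟨h, ht.2⟩ hβp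
  · obtain ⟨q, hq, hvq⟩ := hreg (i + 1) (by omega) (by omega) hik
    rcases lt_or_gt_of_ne hik with h | h
    · refine ⟨_, Polynomial.natDegree_C_mul_derivative_le hq βm, fun t ht _ => ?_⟩
      have : x (i + 1) ≤ x (k - 1) := partition_le hx (by omega) (by omega)
      rw [betaPW, if_pos (by linarith [ht.2])]
      exact Polynomial.hasDerivAt_of_eqOn_Icc hvq ht hβm
    · refine ⟨_, Polynomial.natDegree_C_mul_derivative_le hq βp, fun t ht _ => ?_⟩
      have : x k ≤ x i := partition_le hx (by omega) (by omega)
      rw [betaPW, if_neg (by linarith [ht.1])]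
      exact Polynomial.hasDerivAt_of_eqOn_Icc hvq ht hβp

theorem integral_deriv_eq_sub_of_partition {w : ℝ → ℝ} {w₀ w₁ : ℝ} (hw : IsWeight w α w₀ w₁)
    (hN : 1 ≤ N) (hx : ∀ i, i < N → x i < x (i + 1)) (hv : ContinuousOn v (Icc (x 0) (x N)))
    {q : ℕ → Polynomial ℝ} (hq : ∀ i < N, ∀ t ∈ Ioo (x i) (x (i + 1)), t ≠ α →
      HasDerivAt v ((q i).eval t * w t) t) {y z : ℝ} (hy : x 0 ≤ y) (hyz : y ≤ z)
    (hz : z ≤ x N) :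
    IntervalIntegrable (deriv v) MeasureTheory.volume y z ∧ ∫ t in y..z, deriv v t = v z - v y := by
  have hel : ∀ i < N, IntervalIntegrable (deriv v) MeasureTheory.volume (x i) (x (i + 1)) := by
    intro i hi
    have h1 := hw.intervalIntegrable_mul (q i).continuous.continuousOn
      (left_mem_Icc.2 (hx i hi).le) (right_mem_Icc.2 (hx i hi).le)
    refine h1.congr_ae ?_
    rw [uIoc_of_le (hx i hi).le, ← MeasureTheory.restrict_Ioo_eq_restrict_Ioc]
    filter_upwards [MeasureTheory.ae_restrict_mem measurableSet_Ioo, MeasureTheory.ae_restrict_of_ae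
      (MeasureTheory.compl_mem_ae_iff.2 (MeasureTheory.measure_singleton α))] with t ht htα
    exact (hq i hi t ht htα).deriv.symm
  have hint : IntervalIntegrable (deriv v) MeasureTheory.volume y z := by
    refine (IntervalIntegrable.trans_iterate hel).mono_set ?_
    rw [uIcc_of_le hyz, uIcc_of_le (hy.trans (hyz.trans hz))]
    exact Icc_subset_Icc hy hz
  refine ⟨hint, ?_⟩
  refine MeasureTheory.integral_eq_of_hasDerivAt_off_countable_of_le v (deriv v) hyz
    ((countable_range x).insert α) (hv.mono (Icc_subset_Icc hy hz)) (fun t ht => ?_) hint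
  obtain ⟨i, hi, hti⟩ := exists_mem_partition_Icc hN (hy.trans ht.1.1.le) (ht.1.2.le.trans hz)
  have hne : ∀ n, x n ≠ t := fun n hn => ht.2 (Or.inr ⟨n, hn⟩)
  have := hq i hi t ⟨hti.1.lt_of_ne (hne i), hti.2.lt_of_ne (hne (i + 1)).symm⟩
    fun h => ht.2 (Or.inl h)
  rw [this.deriv]
  exact this

end TrialSpace

theorem collocation_value_const {p N : ℕ} {g : ℕ → ℕ → ℝ} {s : ℝ → ℝ}
    (hglue : ∀ i, 1 ≤ i → i < N → g i (p + 1) = g (i + 1) 1) (hp : 1 ≤ p)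
    (hs : ∀ i, 1 ≤ i → i ≤ N → ∀ j, 1 ≤ j → j ≤ (if i < N then p else p - 1) →
      s (g i j) = s (g i (j + 1))) {i j : ℕ} (hi : i < N) (hj : 1 ≤ j) (hjp : j ≤ p) :
    s (g (i + 1) j) = s (g 1 1) := by
  have hrow : ∀ i < N, ∀ j, 1 ≤ j → j ≤ p → s (g (i + 1) j) = s (g (i + 1) 1) := by
    intro i hi j hj
    induction j, hj using Nat.le_induction with
    | base => exact fun _ => rfl
    | succ n hn ih =>
      intro hnp
      rw [← hs (i + 1) (by omega) (by omega) n hn (by split_ifs <;> omega), ih (by omega)]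
  rw [hrow i hi j hj hjp]
  clear hj hjp
  induction i with
  | zero => rfl
  | succ n ih =>
    rw [← hglue (n + 1) (by omega) hi, ← hs (n + 1) (by omega) (by omega) p hp (by rw [if_pos hi]),
      hrow n (by omega) p hp le_rfl, ih (by omega)]

theorem sqrt_integral_sq_le {a b B : ℝ} {e : ℝ → ℝ} (hab : a ≤ b) (he : ContinuousOn e (Icc a b))
    (hB : ∀ t ∈ Icc a b, |e t| ≤ B) : √(∫ t in a..b, e t ^ 2) ≤ √(b - a) * B := by
  have hB0 : 0 ≤ B := (abs_nonneg _).trans (hB a (left_mem_Icc.2 hab))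
  rw [← Real.sqrt_sq hB0, ← Real.sqrt_mul (sub_nonneg.2 hab)]
  refine Real.sqrt_le_sqrt ?_
  have h := intervalIntegral.integral_mono_on hab
    ((he.pow 2).intervalIntegrable_of_Icc (μ := MeasureTheory.volume) hab)
    intervalIntegrable_const
    fun t ht => (sq_abs (e t)).symm.le.trans (pow_le_pow_left₀ (abs_nonneg _) (hB t ht) 2)
  rwa [intervalIntegral.integral_const, smul_eq_mul] at h

/-- under the hypotheses of the superconvergence theorem, the IFVM solution
converges with optimal order in `L²`: `‖u − u_T‖₀ ≤ C h^{p+1} ‖u‖_{2p+1,∞}`. -/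
theorem stmt_19 (p : ℕ) (hp : 2 ≤ p) (βm βp γ c κ σ d : ℝ)
    (hβm : 0 < βm) (hβp : 0 < βp) (hc : 0 < c) (hκ : 0 < κ) (hσ : 0 < σ) (hd : 0 < d) :
    ∃ h₀ C : ℝ, 0 < h₀ ∧ 0 < C ∧
    (∀ (N k : ℕ) (a b α hm : ℝ) (x : ℕ → ℝ) (g A : ℕ → ℕ → ℝ),
    b - a = d →
    1 ≤ N →
    1 ≤ k →
    k ≤ N →
    a < b →
    x 0 = a →
    x N = b →
    (∀ i, i < N → x i < x (i + 1)) →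
    x (k - 1) < α →
    α < x k →
    (∀ i ∈ Finset.Icc 1 N, ∀ j ∈ Finset.Icc 1 p,
      x (i - 1) < g i j ∧ g i j < x i ∧ g i j ≠ α) →
    (∀ i ∈ Finset.Icc 1 N, ∀ j, 1 ≤ j → j < p → g i j < g i (j + 1)) →
    (∀ i, 1 ≤ i → i < N → g i (p + 1) = g (i + 1) 1) →
    (∀ i ∈ Finset.Icc 1 N, ∀ j ∈ Finset.Icc 1 p, 0 < A i j) →
    (∀ i ∈ Finset.Icc 1 N, ∀ F : Polynomial ℝ, F.natDegree ≤ 2 * p - 1 →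
      ∑ j ∈ Finset.Icc 1 p, A i j * F.eval (g i j)
        = ∫ t in (x (i - 1))..(x i), F.eval t / betaPW βm βp α t) →
    (∀ i ∈ Finset.Icc 1 N, ∀ j ∈ Finset.Icc 1 p, κ * (x i - x (i - 1)) ≤ A i j) →
    (∀ i ∈ Finset.Icc 1 N, ∀ i' ∈ Finset.Icc 1 N,
      x i - x (i - 1) ≤ σ * (x i' - x (i' - 1))) →
    (∀ i ∈ Finset.Icc 1 N, x i - x (i - 1) ≤ hm) →
    hm ≤ h₀ →
    ∀ (f u uT : ℝ → ℝ),
    ContinuousOn f (Set.Ioo a α ∪ Set.Ioo α b) →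
    (∃ Mf : ℝ, ∀ t ∈ Set.Icc a b, |f t| ≤ Mf) →
    MemW (2 * p + 1) a b α βm βp u →
    (∀ t, t ∈ Set.Ioo a α ∪ Set.Ioo α b →
      -(betaPW βm βp α t * iteratedDeriv 2 u t) + γ * deriv u t + c * u t = f t) →
    MemUT p N k a b α βm βp x uT →
    (∀ i, 1 ≤ i → i ≤ N → ∀ j, 1 ≤ j → j ≤ (if i < N then p else p - 1) →
      betaPW βm βp α (g i j) * deriv uT (g i j)
        - betaPW βm βp α (g i (j + 1)) * deriv uT (g i (j + 1))
        + (∫ t in (g i j)..(g i (j + 1)), (γ * deriv uT t + c * uT t))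
        = ∫ t in (g i j)..(g i (j + 1)), f t) →
    Real.sqrt (∫ t in a..b, (u t - uT t) ^ 2)
      ≤ C * hm ^ (p + 1) * wnorm (2 * p + 1) a b α u) := by
  set w₀ := min βm⁻¹ βp⁻¹ with hw₀
  set w₁ := max βm⁻¹ βp⁻¹ with hw₁
  have hw₀pos : 0 < w₀ := lt_min (inv_pos.2 hβm) (inv_pos.2 hβp)
  have hw₁pos : 0 < w₁ := (inv_pos.2 hβm).trans_le (le_max_left _ _)
  have hβ : 0 < max βm βp := hβm.trans_le (le_max_left _ _)
  obtain ⟨h₀, C, hh₀, hC, hmain⟩ :=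
    exists_collocation_error_const p hp w₀ w₁ γ c d hw₀pos hw₁pos hc hd
  refine ⟨h₀, √d * (C * max βm βp), hh₀, by positivity, ?_⟩
  intro N k a b α hm x g A hbad hN hk hkN hab hx0 hxN hx hkl hkr hg hgmono hglue hA hquad _ _ hh hhm
    f u uT _ _ hu hf huT hscheme
  subst hbad
  have haα : a < α := hx0 ▸ (partition_le hx (Nat.zero_le _) (by omega)).trans_lt hkl
  have hαb : α < b := hxN ▸ hkr.trans_le (partition_le hx hkN le_rfl)
  have hw : IsWeight (fun t => (betaPW βm βp α t)⁻¹) α w₀ w₁ := isWeight_inv_betaPW hβm hβp α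
  have hxa : ∀ i ≤ N, a ≤ x i := fun i hi => hx0 ▸ partition_le hx (Nat.zero_le _) hi
  have hxb : ∀ i ≤ N, x i ≤ b := fun i hi => hxN ▸ partition_le hx hi le_rfl
  choose! q hqdeg hqder using fun i (hi : i < N) =>
    huT.exists_flux_polynomial (by omega) hβm hβp hx hk hkN hkl hkr hi
  have hgI : ∀ i < N, ∀ j, 1 ≤ j → j ≤ p →
      g (i + 1) j ∈ Ioo (x i) (x (i + 1)) ∧ g (i + 1) j ≠ α := fun i hi j hj hjp => by
    obtain ⟨h1, h2, h3⟩ := hg (i + 1) (Finset.mem_Icc.2 ⟨by omega, hi⟩) j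
      (Finset.mem_Icc.2 ⟨hj, hjp⟩)
    exact ⟨⟨h1, h2⟩, h3⟩
  set Q := fluxDeriv βm βp a b α u with hQ
  set e : ℝ → ℝ := fun t => u t - uT t with he
  have hec : ContinuousOn e (Icc a b) := hu.1.sub huT.1
  set s : ℝ → ℝ := fun y => γ * e y + c * (∫ t in a..y, e t)
    - (Q 0 y - betaPW βm βp α y * deriv uT y) with hs
  have hstep : ∀ y z, a < y → y ≤ z → z < b →
      betaPW βm βp α y * deriv uT y - betaPW βm βp α z * deriv uT z
        + (∫ t in y..z, (γ * deriv uT t + c * uT t)) = ∫ t in y..z, f t → s y = s z := by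
    intro y z hy hyz hz hyzs
    have haI : a ∈ Icc a b := left_mem_Icc.2 hab.le
    have hyI : y ∈ Icc a b := ⟨hy.le, hyz.trans hz.le⟩
    have hzI : z ∈ Icc a b := ⟨hy.le.trans hyz, hz.le⟩
    have hdT := integral_deriv_eq_sub_of_partition hw hN hx (by rw [hx0, hxN]; exact huT.1) hqder
      (hx0 ▸ hy.le) hyz (hxN ▸ hz.le)
    have huI := hu.1.intervalIntegrable_sub hyI hzI
    have huTI := huT.1.intervalIntegrable_sub hyI hzI
    have hsplit : ∫ t in a..z, e t = (∫ t in a..y, e t) + ∫ t in y..z, e t :=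
      (intervalIntegral.integral_add_adjacent_intervals (hec.intervalIntegrable_sub haI hyI)
        (hec.intervalIntegrable_sub hyI hzI)).symm
    have hesub : ∫ t in y..z, e t = (∫ t in y..z, u t) - ∫ t in y..z, uT t :=
      intervalIntegral.integral_sub huI huTI
    rw [integral_source_eq hβm hβp haα hαb hu (by omega) hf hy hyz hz,
      intervalIntegral.integral_add (hdT.1.const_mul γ) (huTI.const_mul c),
      intervalIntegral.integral_const_mul, intervalIntegral.integral_const_mul, hdT.2] at hyzs
    simp only [hs, hsplit, hesub]
    simp only [he]
    linear_combination hyzs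
  have hsg : ∀ i, 1 ≤ i → i ≤ N → ∀ j, 1 ≤ j → j ≤ (if i < N then p else p - 1) →
      s (g i j) = s (g i (j + 1)) := by
    intro i hi hiN j hj hjp
    obtain ⟨i, rfl⟩ : ∃ n, i = n + 1 := ⟨i - 1, by omega⟩
    have hjp' : j ≤ p := hjp.trans (by split_ifs <;> omega)
    have h1 := (hgI i hiN j hj hjp').1
    rcases hjp'.lt_or_eq with hlt | rfl
    · have h2 := (hgI i hiN (j + 1) (by omega) hlt).1
      exact hstep _ _ ((hxa i (by omega)).trans_lt h1.1)
        (hgmono (i + 1) (Finset.mem_Icc.2 ⟨hi, hiN⟩) j hj hlt).le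
        (h2.2.trans_le (hxb _ hiN)) (hscheme (i + 1) hi hiN j hj hjp)
    · have hiN' : i + 1 < N := by
        by_contra hcon
        rw [if_neg hcon] at hjp
        omega
      have h2 := (hgI (i + 1) hiN' 1 le_rfl hj).1
      rw [← hglue (i + 1) hi hiN'] at h2
      exact hstep _ _ ((hxa i (by omega)).trans_lt h1.1) (h1.2.trans h2.1).le
        (h2.2.trans_le (hxb _ hiN')) (hscheme (i + 1) hi hiN j hj hjp)
  have hbound : ∀ M, 0 < M → (∀ j ≤ p + 1, ∀ t ∈ Icc a b, |Q j t| ≤ M) →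
      ∀ t ∈ Icc a b, |e t| ≤ C * hm ^ (p + 1) * M := by
    intro M hM hQM
    refine hmain N a b α hm (s (g 1 1)) M x g A _ e Q (fun i => q (i - 1)) hw rfl hN hx0 hxN hx
      (fun i hi => hh (i + 1) (Finset.mem_Icc.2 ⟨by omega, hi⟩)) hhm hM
      (fun i hi => hA (i + 1) (Finset.mem_Icc.2 ⟨by omega, hi⟩))
      (fun i hi j hj => Ioo_subset_Icc_self
        (hgI i hi j (Finset.mem_Icc.1 hj).1 (Finset.mem_Icc.1 hj).2).1)
      (fun i hi F hF => ?_) (fun i hi => hqdeg i hi)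
      (fun j hj t ht => hasDerivWithinAt_fluxDeriv haα hαb hu (by omega) ht) hQM hec
      (by simp only [he, hu.2.1, huT.2.1, sub_zero])
      (by simp only [he, hu.2.2.1, huT.2.2.1, sub_zero]) (fun i hi t ht htα => ?_)
      (fun i hi j hj => ?_)
    · simpa only [div_eq_mul_inv, Nat.add_sub_cancel] using hquad (i + 1) (Finset.mem_Icc.2 ⟨by omega, hi⟩) F hF
    · rw [sub_mul]
      exact (hasDerivAt_of_memW hβm hβp hu (by omega)
        ⟨(hxa i hi.le).trans_lt ht.1, ht.2.trans_le (hxb _ hi)⟩ htα).sub (hqder i hi t ht htα)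
    · obtain ⟨hj, hjp⟩ := Finset.mem_Icc.1 hj
      obtain ⟨h1, h2⟩ := hgI i hi j hj hjp
      have h3 := collocation_value_const hglue (by omega) hsg hi hj hjp
      have h4 : betaPW βm βp α (g (i + 1) j) * deriv uT (g (i + 1) j)
          = (q i).eval (g (i + 1) j) := by
        rw [(hqder i hi _ h1 h2).deriv, mul_comm,
          inv_mul_cancel_right₀ (betaPW_pos hβm hβp α _).ne']
      simp only [hs, h4] at h3
      simp only [hs, Nat.add_sub_cancel]
      linear_combination -h3
  have hQW : ∀ j ≤ p + 1, ∀ t ∈ Icc a b,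
      |Q j t| ≤ max βm βp * wnorm (2 * p + 1) a b α u := fun j hj t ht =>
    abs_fluxDeriv_le hβm hβp haα hαb hu (by omega) ht
  have hW : 0 ≤ max βm βp * wnorm (2 * p + 1) a b α u :=
    (abs_nonneg _).trans (hQW 0 (by omega) a (left_mem_Icc.2 hab.le))
  have hhm0 : 0 ≤ hm := by
    have := hh 1 (Finset.mem_Icc.2 ⟨le_rfl, hN⟩)
    have := hx 0 hN
    simp only [Nat.sub_self, zero_add] at *
    linarith
  have hsup : ∀ t ∈ Icc a b,
      |e t| ≤ C * hm ^ (p + 1) * (max βm βp * wnorm (2 * p + 1) a b α u) := by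
    intro t ht
    have hlim : Filter.Tendsto
        (fun δ => C * hm ^ (p + 1) * (max βm βp * wnorm (2 * p + 1) a b α u + δ))
        (nhdsWithin 0 (Ioi 0))
        (nhds (C * hm ^ (p + 1) * (max βm βp * wnorm (2 * p + 1) a b α u + 0))) :=
      Filter.Tendsto.mono_left (Continuous.tendsto (by fun_prop) 0) nhdsWithin_le_nhds
    rw [add_zero] at hlim
    refine ge_of_tendsto hlim ?_
    filter_upwards [self_mem_nhdsWithin] with δ hδ
    have hδ' : 0 < δ := hδ
    exact hbound _ (by linarith) (fun j hj t ht => (hQW j hj t ht).trans (by linarith)) t ht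
  refine (sqrt_integral_sq_le hab.le hec hsup).trans_eq ?_
  ring
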